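/- arXiv:2404.06585 — 4 statements merged into one kernel-verified Lean document; each statement's English description precedes it below -/
import Mathlib

section
/- Let 123 denote the identity pattern in S_3 and let B be the event {X_1 > X_2}, which has μ(B) = 1/2. Then (1/μ(B)) ∫_B (T_{123} − 2) dμ = √3·tan(√3/2 + π/6) − 3. -/
open MeasureTheory ProbabilityTheory Real

noncomputable section

/-- The window of `x` of length `k` starting at position `i` (0-indexed) is a consecutive
occurrence of the pattern `σ`, i.e., its standardization is `σ` (relative orders agree). -/
def OccursAt {k : ℕ} (σ : Equiv.Perm (Fin k)) (x : ℕ → ℝ) (i : ℕ) : Prop :=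
  ∀ a b : Fin k, x (i + a) < x (i + b) ↔ σ a < σ b

/-- `hitTime σ x` is the number of draws until the first consecutive occurrence of `σ`,
i.e., the least `j ≥ k` such that the window `x_{j-k}, …, x_{j-1}` is an occurrence of `σ`. -/
def hitTime {k : ℕ} (σ : Equiv.Perm (Fin k)) (x : ℕ → ℝ) : ℕ :=
  sInf {j | k ≤ j ∧ OccursAt σ x (j - k)}

/-- `μ` is the law of an i.i.d. sequence of uniform random variables on `[0,1]`:
a probability measure on `ℕ → ℝ` whose finite-dimensional marginals are products of
the uniform measure on `[0,1]`. -/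
def IsIIDUniform (μ : Measure (ℕ → ℝ)) : Prop :=
  IsProbabilityMeasure μ ∧
  ∀ n : ℕ, μ.map (fun x (i : Fin n) => x i) =
    Measure.pi (fun _ : Fin n => (volume : Measure ℝ).restrict (Set.Icc 0 1))

/-- The pattern `σ ∈ S_k` occurs consecutively at position `i` (0-indexed) in the
permutation `p ∈ S_n`, written in one-line notation. -/
def PermOccursAt {k n : ℕ} (σ : Equiv.Perm (Fin k)) (p : Equiv.Perm (Fin n)) (i : ℕ) : Prop :=
  ∃ h : i + k ≤ n, ∀ a b : Fin k,
    p ⟨i + a, Nat.lt_of_lt_of_le (Nat.add_lt_add_left a.isLt i) h⟩ <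
      p ⟨i + b, Nat.lt_of_lt_of_le (Nat.add_lt_add_left b.isLt i) h⟩ ↔ σ a < σ b

/-- `avoidCount σ n` is the number `α_n(σ)` of permutations in `S_n` avoiding `σ`
as a consecutive pattern. -/
def avoidCount {k : ℕ} (σ : Equiv.Perm (Fin k)) (n : ℕ) : ℕ :=
  Nat.card {p : Equiv.Perm (Fin n) // ∀ i, ¬ PermOccursAt σ p i}

/-- Neither of the patterns `σ`, `τ` contains a consecutive occurrence of the other. -/
def Incomparable {k l : ℕ} (σ : Equiv.Perm (Fin k)) (τ : Equiv.Perm (Fin l)) : Prop :=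
  (∀ i, ¬ PermOccursAt σ τ i) ∧ (∀ i, ¬ PermOccursAt τ σ i)

/-- Uniform measure on the unit interval. -/
def unifM : Measure ℝ := (volume : Measure ℝ).restrict (Set.Icc 0 1)

instance unifM_prob : IsProbabilityMeasure unifM := by
  constructor
  simp [unifM]

lemma iid_box (μ : Measure (ℕ → ℝ)) (hμ : IsIIDUniform μ) (s : Finset ℕ) (t : ℕ → Set ℝ)
    (ht : ∀ i, MeasurableSet (t i)) :
    μ (Set.pi (s : Set ℕ) t) = ∏ i ∈ s, unifM (t i) := by
  classical
  obtain ⟨N, hN⟩ : ∃ N, s ⊆ Finset.range N := s.exists_nat_subset_range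
  have hpre : Set.pi (s : Set ℕ) t = (fun (x : ℕ → ℝ) (i : Fin N) => x i) ⁻¹'
      (Set.pi Set.univ (fun i : Fin N => if (i : ℕ) ∈ s then t i else Set.univ)) := by
    ext x
    simp only [Set.mem_pi, Set.mem_preimage, Set.mem_univ, forall_true_left]
    constructor
    · intro h i
      split_ifs with hi
      · exact h i hi
      · trivial
    · intro h i hi
      have := h ⟨i, Finset.mem_range.1 (hN hi)⟩
      have hi' : i ∈ s := hi
      simpa [hi'] using this
  have hm : MeasurableSet (Set.pi Set.univ
      (fun i : Fin N => if (i : ℕ) ∈ s then t i else Set.univ)) := by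
    refine MeasurableSet.univ_pi fun i => ?_
    split_ifs
    · exact ht _
    · exact MeasurableSet.univ
  rw [hpre, ← Measure.map_apply (by fun_prop) hm, hμ.2 N]
  change Measure.pi (fun _ : Fin N => unifM) _ = _
  rw [Measure.pi_pi]
  rw [Fin.prod_univ_eq_prod_range (fun i => unifM (if i ∈ s then t i else Set.univ)) N]
  have : ∀ i ∈ Finset.range N, unifM (if i ∈ s then t i else Set.univ)
      = if i ∈ s then unifM (t i) else 1 := by
    intro i _
    split_ifs <;> simp
  rw [Finset.prod_congr rfl this, Finset.prod_ite_mem, Finset.inter_eq_right.2 hN]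

lemma iid_eq (μ : Measure (ℕ → ℝ)) (hμ : IsIIDUniform μ) :
    μ = Measure.infinitePi (fun _ : ℕ => unifM) := by
  refine Measure.eq_infinitePi _ fun s t ht => ?_
  exact iid_box μ hμ s t ht

lemma meas_update (n : ℕ) :
    Measurable (fun p : (ℕ → ℝ) × ℝ => Function.update p.1 n p.2) := by
  refine measurable_pi_iff.2 fun i => ?_
  by_cases h : i = n
  · subst h; simpa using measurable_snd
  · simp only [Function.update_of_ne h]; fun_prop

lemma resample (μ : Measure (ℕ → ℝ)) (hμ : IsIIDUniform μ) (n : ℕ) :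
    MeasurePreserving (fun p : (ℕ → ℝ) × ℝ => Function.update p.1 n p.2)
      (μ.prod unifM) μ := by
  classical
  have := hμ.1
  refine ⟨meas_update n, ?_⟩
  conv_rhs => rw [iid_eq μ hμ]
  refine Measure.eq_infinitePi _ fun s t ht => ?_
  rw [Measure.map_apply (meas_update n)
    (MeasurableSet.pi s.countable_toSet (fun i _ => ht i))]
  have hpre : (fun p : (ℕ → ℝ) × ℝ => Function.update p.1 n p.2) ⁻¹' (Set.pi (s : Set ℕ) t)
      = (Set.pi ((s.erase n : Finset ℕ) : Set ℕ) t) ×ˢ (if n ∈ s then t n else Set.univ) := by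
    ext ⟨x, y⟩
    simp only [Set.mem_preimage, Set.mem_pi, Set.mem_prod, Finset.mem_coe, Finset.mem_erase]
    constructor
    · intro h
      refine ⟨fun i hi => ?_, ?_⟩
      · simpa [Function.update_of_ne hi.1] using h i hi.2
      · split_ifs with hn
        · simpa using h n hn
        · trivial
    · rintro ⟨h1, h2⟩ i hi
      by_cases hin : i = n
      · subst hin; simpa [hi] using h2
      · simpa [Function.update_of_ne hin] using h1 i ⟨hin, hi⟩
  rw [hpre, Measure.prod_prod, iid_box μ hμ _ t ht]
  split_ifs with hn
  · rw [mul_comm, Finset.mul_prod_erase s (fun i => unifM (t i)) hn]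
  · simp [Finset.erase_eq_of_notMem hn]

lemma integral_resample (μ : Measure (ℕ → ℝ)) (hμ : IsIIDUniform μ) (n : ℕ)
    (f : (ℕ → ℝ) → ℝ) (hf : Integrable f μ) :
    ∫ x, f x ∂μ = ∫ x, ∫ y, f (Function.update x n y) ∂unifM ∂μ := by
  have := hμ.1
  have hp := resample μ hμ n
  have hfm : AEStronglyMeasurable f (Measure.map
      (fun p : (ℕ → ℝ) × ℝ => Function.update p.1 n p.2) (μ.prod unifM)) := by
    rw [hp.map_eq]; exact hf.aestronglyMeasurable
  conv_lhs => rw [← hp.map_eq]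
  rw [integral_map hp.measurable.aemeasurable hfm]
  rw [integral_prod]
  exact hp.integrable_comp_of_integrable hf

lemma ae_mem (μ : Measure (ℕ → ℝ)) (hμ : IsIIDUniform μ) (n : ℕ) :
    ∀ᵐ x ∂μ, x n ∈ Set.Icc (0:ℝ) 1 := by
  have := hμ.1
  have hm : MeasurableSet (Set.pi (({n} : Finset ℕ) : Set ℕ) (fun _ => Set.Icc (0:ℝ) 1)) :=
    MeasurableSet.pi (Finset.countable_toSet _) (fun i _ => measurableSet_Icc)
  have h1 := iid_box μ hμ {n} (fun _ => Set.Icc (0:ℝ) 1) (fun _ => measurableSet_Icc)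
  have h2 : unifM (Set.Icc (0:ℝ) 1) = 1 := by simp [unifM]
  rw [Finset.prod_singleton, h2] at h1
  have h3 := (mem_ae_iff_prob_eq_one hm).2 h1
  filter_upwards [h3] with x hx
  exact hx n (by simp)

lemma int_split (p q : ℝ → ℝ) (hp : Continuous p) (hq : Continuous q) (a : ℝ)
    (ha : a ∈ Set.Icc (0:ℝ) 1) :
    ∫ y, (if a < y then p y else q y) ∂unifM = (∫ y in (0:ℝ)..a, q y) + ∫ y in a..1, p y := by
  unfold unifM
  rw [integral_Icc_eq_integral_Ioc, ← intervalIntegral.integral_of_le zero_le_one]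
  have h1 : Set.EqOn (fun y => if a < y then p y else q y) q (Set.uIoc 0 a) := by
    intro y hy
    rw [Set.uIoc_of_le ha.1] at hy
    simp [not_lt.2 hy.2]
  have h2 : Set.EqOn (fun y => if a < y then p y else q y) p (Set.uIoc a 1) := by
    intro y hy
    rw [Set.uIoc_of_le ha.2] at hy
    simp [hy.1]
  rw [← intervalIntegral.integral_add_adjacent_intervals (b := a)]
  · rw [intervalIntegral.integral_congr_ae (Filter.Eventually.of_forall h1),
      intervalIntegral.integral_congr_ae (Filter.Eventually.of_forall h2)]
  · exact (hq.intervalIntegrable _ _).congr h1.symm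
  · exact (hp.intervalIntegrable _ _).congr h2.symm

/-- parameter -/
def cc : ℝ := Real.tan (Real.sqrt 3 / 2 + Real.pi / 6)
/-- half root three -/
def ww : ℝ := Real.sqrt 3 / 2
/-- Expected remaining time after an ascent to `x`. -/
def GG (x : ℝ) : ℝ := Real.exp (x / 2) * (Real.cos (ww * x) + cc * Real.sin (ww * x))
/-- Expected remaining time after a descent to `x`. -/
def FF (x : ℝ) : ℝ := Real.exp (x / 2) *
  ((1 / 2 + cc * ww) * Real.cos (ww * x) + (cc / 2 - ww) * Real.sin (ww * x))

lemma ww_sq : ww * ww = 3 / 4 := by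
  unfold ww
  have := Real.mul_self_sqrt (show (0:ℝ) ≤ 3 by norm_num)
  nlinarith

lemma hG (x : ℝ) : HasDerivAt GG (FF x) x := by
  have h1 : HasDerivAt (fun x : ℝ => ww * x) ww x := by
    simpa using (hasDerivAt_id x).const_mul ww
  have h2 : HasDerivAt (fun x : ℝ => x / 2) (1 / 2) x := (hasDerivAt_id x).div_const 2
  have := h2.exp.mul (h1.cos.add (h1.sin.const_mul cc))
  refine this.congr_deriv ?_
  unfold FF
  simp only [Pi.add_apply]
  ring

lemma hF (x : ℝ) : HasDerivAt FF (FF x - GG x) x := by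
  have h1 : HasDerivAt (fun x : ℝ => ww * x) ww x := by
    simpa using (hasDerivAt_id x).const_mul ww
  have h2 : HasDerivAt (fun x : ℝ => x / 2) (1 / 2) x := (hasDerivAt_id x).div_const 2
  have := h2.exp.mul ((h1.cos.const_mul (1 / 2 + cc * ww)).add (h1.sin.const_mul (cc / 2 - ww)))
  refine this.congr_deriv ?_
  unfold FF GG
  simp only [Pi.add_apply]
  linear_combination (-Real.exp (x / 2) * (Real.cos (ww * x) + cc * Real.sin (ww * x))) * ww_sq

lemma contG : Continuous GG := by unfold GG; fun_prop
lemma contF : Continuous FF := by unfold FF; fun_prop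

lemma sqrt3_lt : Real.sqrt 3 < 1.7321 := by
  rw [Real.sqrt_lt' (by norm_num)]; norm_num
lemma lt_sqrt3 : 1.732 < Real.sqrt 3 := by
  rw [Real.lt_sqrt (by norm_num)]; norm_num

lemma ang_lt : Real.sqrt 3 / 2 + Real.pi / 6 < Real.pi / 2 := by
  have := sqrt3_lt
  have := Real.pi_gt_d2
  norm_num at *
  linarith

lemma cos_ang_pos : 0 < Real.cos (Real.sqrt 3 / 2 + Real.pi / 6) := by
  have := lt_sqrt3
  have := Real.pi_gt_d2
  apply Real.cos_pos_of_mem_Ioo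
  constructor
  · norm_num at *; linarith
  · exact ang_lt

lemma cc_ge : Real.sqrt 3 ≤ cc := by
  unfold cc
  suffices h : Real.tan (Real.pi / 3) ≤ Real.tan (Real.sqrt 3 / 2 + Real.pi / 6) by
    rwa [Real.tan_pi_div_three] at h
  have := lt_sqrt3
  have := Real.pi_lt_d2
  have := Real.pi_gt_d2
  refine (Real.strictMonoOn_tan.le_iff_le ?_ ?_).2 ?_
  · constructor <;> linarith
  · constructor
    · norm_num at *; linarith
    · exact ang_lt
  · norm_num at *; linarith

lemma G_zero : GG 0 = 1 := by simp [GG]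
lemma F_zero : FF 0 = 1 / 2 + cc * ww := by simp [FF]

lemma F_one : FF 1 = GG 1 := by
  have hc := cos_ang_pos
  have h : cc * Real.cos (Real.sqrt 3 / 2 + Real.pi / 6)
      = Real.sin (Real.sqrt 3 / 2 + Real.pi / 6) := by
    unfold cc
    rw [Real.tan_eq_sin_div_cos, div_mul_cancel₀ _ hc.ne']
  rw [Real.cos_add, Real.sin_add, Real.cos_pi_div_six, Real.sin_pi_div_six] at h
  change cc * (Real.cos ww * ww - Real.sin ww * (1/2)) = Real.sin ww * ww + Real.cos ww * (1/2) at h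
  unfold FF GG
  rw [mul_one]
  linear_combination Real.exp (1/2) * h

lemma nonneg_FG (x : ℝ) (hx : x ∈ Set.Icc (0:ℝ) 1) : 0 ≤ FF x ∧ 0 ≤ GG x := by
  have h1 := cc_ge
  have h2 := lt_sqrt3
  have h3 := sqrt3_lt
  have h4 := Real.pi_gt_d2
  have hw : 0 < ww := by unfold ww; positivity
  have hw1 : ww < 1 := by unfold ww; norm_num at *; linarith
  have hwx : 0 ≤ ww * x := mul_nonneg hw.le hx.1
  have hwx1 : ww * x ≤ 1 := mul_le_one₀ hw1.le hx.1 hx.2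
  have hs : 0 ≤ Real.sin (ww * x) := Real.sin_nonneg_of_nonneg_of_le_pi hwx (by linarith)
  have hco : 0 ≤ Real.cos (ww * x) := Real.cos_nonneg_of_neg_pi_div_two_le_of_le
    (by linarith) (by linarith)
  have hc0 : 0 ≤ cc := le_trans (Real.sqrt_nonneg 3) h1
  have hcw : 0 ≤ cc / 2 - ww := by unfold ww; linarith
  unfold FF GG
  constructor <;> positivity

lemma int_F (a b : ℝ) : ∫ y in a..b, FF y = GG b - GG a :=
  intervalIntegral.integral_eq_sub_of_hasDerivAt (fun x _ => hG x) (contF.intervalIntegrable _ _)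

lemma int_G (a : ℝ) : ∫ y in a..1, GG y = FF a - GG a := by
  have : ∀ x ∈ Set.uIcc a 1, HasDerivAt (fun x => GG x - FF x) (GG x) x := fun x _ =>
    ((hG x).sub (hF x)).congr_deriv (by ring)
  rw [intervalIntegral.integral_eq_sub_of_hasDerivAt this (contG.intervalIntegrable _ _), F_one]
  ring

lemma int_last : ∫ y in (0:ℝ)..1, (1 - y) * FF y = FF 0 - 2 := by
  have : ∀ x ∈ Set.uIcc (0:ℝ) 1,
      HasDerivAt (fun x => (1 - x) * GG x + (GG x - FF x)) ((1 - x) * FF x) x := fun x _ =>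
    ((((hasDerivAt_id x).const_sub 1).mul (hG x)).add ((hG x).sub (hF x))).congr_deriv
      (by simp only [id]; ring)
  have hc : Continuous (fun y => (1 - y) * FF y) := by have := contF; fun_prop
  rw [intervalIntegral.integral_eq_sub_of_hasDerivAt this (hc.intervalIntegrable _ _), F_one,
    G_zero]
  ring

/-- No window of the pattern starts before `n`, and the start is a descent. -/
def AA (n : ℕ) : Set (ℕ → ℝ) :=
  {x | x 1 < x 0 ∧ ∀ i < n, ¬ (x i < x (i + 1) ∧ x (i + 1) < x (i + 2))}

open Classical in
/-- The potential. -/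
def Ph (n : ℕ) (x : ℕ → ℝ) : ℝ :=
  if x ∈ AA n then (if x n < x (n + 1) then GG (x (n + 1)) else FF (x (n + 1))) else 0

lemma meas_lt (i j : ℕ) : MeasurableSet {x : ℕ → ℝ | x i < x j} :=
  measurableSet_lt (measurable_pi_apply i) (measurable_pi_apply j)

lemma meas_AA (n : ℕ) : MeasurableSet (AA n) := by
  have : AA n = {x | x 1 < x 0} ∩ ⋂ i ∈ Finset.range n,
      ({x | x i < x (i + 1)} ∩ {x | x (i + 1) < x (i + 2)})ᶜ := by
    ext x
    simp [AA]
  rw [this]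
  exact (meas_lt _ _).inter (Finset.measurableSet_biInter _ fun i _ =>
    ((meas_lt _ _).inter (meas_lt _ _)).compl)

lemma meas_Ph (n : ℕ) : Measurable (Ph n) := by
  unfold Ph
  refine Measurable.ite (meas_AA n) ?_ measurable_const
  exact Measurable.ite (meas_lt _ _) (contG.measurable.comp (measurable_pi_apply _))
    (contF.measurable.comp (measurable_pi_apply _))

lemma exists_bd : ∃ C : ℝ, 0 ≤ C ∧ ∀ x ∈ Set.Icc (0:ℝ) 1, FF x ≤ C ∧ GG x ≤ C := by
  obtain ⟨C1, h1⟩ := isCompact_Icc.exists_bound_of_continuousOn (s := Set.Icc (0:ℝ) 1)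
    contF.continuousOn
  obtain ⟨C2, h2⟩ := isCompact_Icc.exists_bound_of_continuousOn (s := Set.Icc (0:ℝ) 1)
    contG.continuousOn
  refine ⟨max 0 (max C1 C2), le_max_left _ _, fun x hx => ⟨?_, ?_⟩⟩
  · exact ((le_abs_self _).trans (h1 x hx)).trans ((le_max_left _ _).trans (le_max_right _ _))
  · exact ((le_abs_self _).trans (h2 x hx)).trans ((le_max_right _ _).trans (le_max_right _ _))

lemma Ph_nonneg (n : ℕ) (x : ℕ → ℝ) (hx : x (n + 1) ∈ Set.Icc (0:ℝ) 1) : 0 ≤ Ph n x := by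
  have := nonneg_FG _ hx
  unfold Ph
  split_ifs
  · exact this.2
  · exact this.1
  · exact le_rfl

lemma Ph_le (C : ℝ) (hC : ∀ x ∈ Set.Icc (0:ℝ) 1, FF x ≤ C ∧ GG x ≤ C)
    (n : ℕ) (x : ℕ → ℝ) (hx : x (n + 1) ∈ Set.Icc (0:ℝ) 1) :
    Ph n x ≤ (AA n).indicator (fun _ => C) x := by
  unfold Ph
  by_cases h : x ∈ AA n
  · rw [if_pos h, Set.indicator_of_mem h]
    split_ifs
    · exact (hC _ hx).2
    · exact (hC _ hx).1
  · rw [if_neg h, Set.indicator_of_notMem h]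

lemma integrable_ind (μ : Measure (ℕ → ℝ)) [IsProbabilityMeasure μ] (n : ℕ) (C : ℝ) :
    Integrable ((AA n).indicator (fun _ => C)) μ :=
  (integrable_const C).indicator (meas_AA n)

lemma integral_ind (μ : Measure (ℕ → ℝ)) [IsProbabilityMeasure μ] (n : ℕ) (C : ℝ) :
    ∫ x, (AA n).indicator (fun _ => C) x ∂μ = μ.real (AA n) * C := by
  rw [integral_indicator (meas_AA n)]
  simp

lemma integrable_Ph (μ : Measure (ℕ → ℝ)) (hμ : IsIIDUniform μ) (n : ℕ) :
    Integrable (Ph n) μ := by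
  have := hμ.1
  obtain ⟨C, hC0, hC⟩ := exists_bd
  refine Integrable.mono' (integrable_ind μ n C) (meas_Ph n).aestronglyMeasurable ?_
  filter_upwards [ae_mem μ hμ (n + 1)] with x hx
  rw [Real.norm_eq_abs, abs_of_nonneg (Ph_nonneg n x hx)]
  exact Ph_le C hC n x hx

lemma AA_update (n : ℕ) (x : ℕ → ℝ) (y : ℝ) :
    Function.update x (n + 2) y ∈ AA (n + 1) ↔
      x ∈ AA n ∧ ¬ (x n < x (n + 1) ∧ x (n + 1) < y) := by
  have e : ∀ i, i < n + 2 → Function.update x (n + 2) y i = x i := fun i hi =>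
    Function.update_of_ne (by omega) _ _
  have e' : Function.update x (n + 2) y (n + 2) = y := Function.update_self _ _ _
  unfold AA
  simp only [Set.mem_ofPred_eq]
  rw [e 0 (by omega), e 1 (by omega)]
  constructor
  · rintro ⟨h0, h⟩
    refine ⟨⟨h0, fun i hi => ?_⟩, ?_⟩
    · have := h i (by omega)
      rwa [e i (by omega), e (i + 1) (by omega), e (i + 2) (by omega)] at this
    · have := h n (by omega)
      rwa [e n (by omega), e (n + 1) (by omega), e'] at this
  · rintro ⟨⟨h0, h⟩, h2⟩
    refine ⟨h0, fun i hi => ?_⟩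
    rcases Nat.lt_succ_iff_lt_or_eq.1 hi with hi | rfl
    · rw [e i (by omega), e (i + 1) (by omega), e (i + 2) (by omega)]
      exact h i hi
    · rw [e i (by omega), e (i + 1) (by omega), e']
      exact h2

lemma Ph_update (n : ℕ) (x : ℕ → ℝ) (hx : x (n + 1) ∈ Set.Icc (0:ℝ) 1) :
    ∫ y, Ph (n + 1) (Function.update x (n + 2) y) ∂unifM
      = Ph n x - (AA n).indicator (fun _ => (1:ℝ)) x := by
  classical
  have e1 : ∀ y, Function.update x (n + 2) y (n + 1) = x (n + 1) := fun y =>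
    Function.update_of_ne (by omega) _ _
  have e' : ∀ y, Function.update x (n + 2) y (n + 2) = y := fun y => Function.update_self _ _ _
  have key : ∀ y, Ph (n + 1) (Function.update x (n + 2) y) =
      if x ∈ AA n ∧ ¬ (x n < x (n + 1) ∧ x (n + 1) < y) then
        (if x (n + 1) < y then GG y else FF y) else 0 := by
    intro y
    unfold Ph
    simp only [AA_update, show n + 1 + 1 = n + 2 from rfl, e1, e']
  simp_rw [key]
  by_cases h : x ∈ AA n
  · rw [Set.indicator_of_mem h]
    unfold Ph
    rw [if_pos h]
    by_cases ha : x n < x (n + 1)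
    · have : ∀ y, (if x ∈ AA n ∧ ¬ (x n < x (n + 1) ∧ x (n + 1) < y) then
        (if x (n + 1) < y then GG y else FF y) else 0)
          = if x (n + 1) < y then (fun _ => (0:ℝ)) y else FF y := by
        intro y
        by_cases hy : x (n + 1) < y <;> simp [h, ha, hy]
      simp_rw [this]
      rw [int_split _ _ continuous_const contF _ hx, if_pos ha, int_F, G_zero]
      simp
    · have : ∀ y, (if x ∈ AA n ∧ ¬ (x n < x (n + 1) ∧ x (n + 1) < y) then
        (if x (n + 1) < y then GG y else FF y) else 0)
          = if x (n + 1) < y then GG y else FF y := by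
        intro y
        simp [h, ha]
      simp_rw [this]
      rw [int_split _ _ contG contF _ hx, if_neg ha, int_F, int_G, G_zero]
      ring
  · simp [h, Ph]

lemma step (μ : Measure (ℕ → ℝ)) (hμ : IsIIDUniform μ) (n : ℕ) :
    ∫ x, Ph (n + 1) x ∂μ = ∫ x, Ph n x ∂μ - μ.real (AA n) := by
  have := hμ.1
  rw [integral_resample μ hμ (n + 2) _ (integrable_Ph μ hμ (n + 1))]
  have : (fun x => ∫ y, Ph (n + 1) (Function.update x (n + 2) y) ∂unifM) =ᵐ[μ]
      fun x => Ph n x - (AA n).indicator (fun _ => (1:ℝ)) x := by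
    filter_upwards [ae_mem μ hμ (n + 1)] with x hx
    exact Ph_update n x hx
  rw [integral_congr_ae this, integral_sub (integrable_Ph μ hμ n) (integrable_ind μ n 1),
    integral_ind, mul_one]

lemma partial_sum (μ : Measure (ℕ → ℝ)) (hμ : IsIIDUniform μ) (n : ℕ) :
    ∑ k ∈ Finset.range n, μ.real (AA k) = ∫ x, Ph 0 x ∂μ - ∫ x, Ph n x ∂μ := by
  induction n with
  | zero => simp
  | succ n ih => rw [Finset.sum_range_succ, ih, step μ hμ n]; ring

lemma hasSum_AA (μ : Measure (ℕ → ℝ)) (hμ : IsIIDUniform μ) :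
    HasSum (fun k => μ.real (AA k)) (∫ x, Ph 0 x ∂μ) := by
  have := hμ.1
  have hnn : ∀ n, 0 ≤ ∫ x, Ph n x ∂μ := fun n => by
    refine integral_nonneg_of_ae ?_
    filter_upwards [ae_mem μ hμ (n + 1)] with x hx
    exact Ph_nonneg n x hx
  have hs : Summable (fun k => μ.real (AA k)) := by
    refine summable_of_sum_range_le (c := ∫ x, Ph 0 x ∂μ) (fun _ => measureReal_nonneg) ?_
    intro n
    rw [partial_sum μ hμ n]
    linarith [hnn n]
  have h0 := hs.tendsto_atTop_zero
  obtain ⟨C, hC0, hC⟩ := exists_bd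
  have hP : Filter.Tendsto (fun n => ∫ x, Ph n x ∂μ) Filter.atTop (nhds 0) := by
    have h1 : Filter.Tendsto (fun n => μ.real (AA n) * C) Filter.atTop (nhds 0) := by
      simpa using h0.mul_const C
    refine squeeze_zero hnn (fun n => ?_) h1
    rw [← integral_ind μ n C]
    refine integral_mono_ae (integrable_Ph μ hμ n) (integrable_ind μ n C) ?_
    filter_upwards [ae_mem μ hμ (n + 1)] with x hx
    exact Ph_le C hC n x hx
  rw [hs.hasSum_iff_tendsto_nat]
  simp_rw [partial_sum μ hμ]
  simpa using hP.const_sub (∫ x, Ph 0 x ∂μ)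

lemma occurs_iff (x : ℕ → ℝ) (i : ℕ) :
    OccursAt (1 : Equiv.Perm (Fin 3)) x i ↔ x i < x (i + 1) ∧ x (i + 1) < x (i + 2) := by
  constructor
  · intro h
    have h1 := (h 0 1).2 (by decide)
    have h2 := (h 1 2).2 (by decide)
    exact ⟨by simpa using h1, by simpa using h2⟩
  · rintro ⟨h1, h2⟩ a b
    have h3 := h1.trans h2
    fin_cases a <;> fin_cases b <;> simp [h1, h2, h3, h1.le, h2.le, h3.le]

lemma tsum_ind (x : ℕ → ℝ) (hB : x 1 < x 0) (hx : ∃ n, x ∉ AA n) :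
    ∑' n, (AA n).indicator (fun _ => (1:ℝ)) x
      = (hitTime (1 : Equiv.Perm (Fin 3)) x : ℝ) - 2 := by
  classical
  have hex : ∃ i, x i < x (i + 1) ∧ x (i + 1) < x (i + 2) := by
    obtain ⟨n, hn⟩ := hx
    by_contra hcon
    push Not at hcon
    exact hn ⟨hB, fun i _ h => absurd h.2 (not_lt.2 (hcon i h.1))⟩
  set m := Nat.find hex with hm
  have hT : hitTime (1 : Equiv.Perm (Fin 3)) x = m + 3 := by
    unfold hitTime
    apply le_antisymm
    · apply Nat.sInf_le
      refine ⟨by omega, ?_⟩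
      rw [occurs_iff]
      exact Nat.find_spec hex
    · refine le_csInf ⟨m + 3, by omega, ?_⟩ ?_
      · rw [occurs_iff]
        exact Nat.find_spec hex
      · rintro j ⟨hj, ho⟩
        rw [occurs_iff] at ho
        have := Nat.find_min' hex ho
        omega
  have hA : ∀ n, x ∈ AA n ↔ n ∈ Finset.range (m + 1) := by
    intro n
    rw [Finset.mem_range]
    constructor
    · intro h
      by_contra hcon
      exact h.2 m (by omega) (Nat.find_spec hex)
    · intro h
      exact ⟨hB, fun i hi => Nat.find_min hex (by omega)⟩
  rw [tsum_eq_sum (s := Finset.range (m + 1))]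
  · rw [Finset.sum_congr rfl (g := fun _ => (1:ℝ))]
    · simp [hT]; ring
    · intro n hn
      exact Set.indicator_of_mem ((hA n).2 hn) _
  · intro n hn
    exact Set.indicator_of_notMem (fun h => hn ((hA n).1 h)) _

lemma integral_T (μ : Measure (ℕ → ℝ)) (hμ : IsIIDUniform μ) :
    ∫ x in {x : ℕ → ℝ | x 1 < x 0}, ((hitTime (1 : Equiv.Perm (Fin 3)) x : ℝ) - 2) ∂μ
      = ∫ x, Ph 0 x ∂μ := by
  have := hμ.1
  have hs := hasSum_AA μ hμ
  have h1 := hasSum_integral_of_summable_integral_norm (μ := μ)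
    (F := fun n x => (AA n).indicator (fun _ => (1:ℝ)) x) (fun n => integrable_ind μ n 1) (by
      refine hs.summable.congr fun n => ?_
      rw [← mul_one (μ.real (AA n)), ← integral_ind μ n 1]
      refine integral_congr_ae (Filter.Eventually.of_forall fun x => ?_)
      exact (Real.norm_of_nonneg (Set.indicator_nonneg (fun _ _ => zero_le_one) x)).symm)
  simp_rw [integral_ind, mul_one] at h1
  rw [hs.unique h1, ← integral_indicator (meas_lt 1 0)]
  refine integral_congr_ae ?_
  have hz : ∀ᵐ x ∂μ, ∃ n, x ∉ AA n := by
    have hnull : μ (⋂ n, AA n) = 0 := by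
      have hr : μ.real (⋂ n, AA n) ≤ 0 :=
        ge_of_tendsto' hs.summable.tendsto_atTop_zero fun n =>
          measureReal_mono (Set.iInter_subset _ n)
      have := le_antisymm hr measureReal_nonneg
      rwa [measureReal_eq_zero_iff] at this
    rw [ae_iff]
    convert hnull using 2
    ext x
    simp
  filter_upwards [hz] with x hx
  by_cases hB : x 1 < x 0
  · rw [Set.indicator_of_mem (show x ∈ {x : ℕ → ℝ | x 1 < x 0} from hB)]
    exact (tsum_ind x hB hx).symm
  · rw [Set.indicator_of_notMem (show x ∉ {x : ℕ → ℝ | x 1 < x 0} from hB)]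
    have : ∀ n, (AA n).indicator (fun _ => (1:ℝ)) x = 0 := fun n =>
      Set.indicator_of_notMem (fun h => hB h.1) _
    simp [this]

/-- Integrals over the initial descent reduce to one-dimensional integrals. -/
lemma integral_first (μ : Measure (ℕ → ℝ)) (hμ : IsIIDUniform μ) (f : ℝ → ℝ)
    (hf : Continuous f)
    (hi : Integrable ({x : ℕ → ℝ | x 1 < x 0}.indicator (fun x => f (x 1))) μ) :
    ∫ x, {x : ℕ → ℝ | x 1 < x 0}.indicator (fun x => f (x 1)) x ∂μ
      = ∫ y in (0:ℝ)..1, (1 - y) * f y := by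
  have := hμ.1
  have hc : Continuous (fun y => (1 - y) * f y) := by fun_prop
  have hae : (fun x => ∫ y, {x : ℕ → ℝ | x 1 < x 0}.indicator (fun x => f (x 1))
      (Function.update x 0 y) ∂unifM) =ᵐ[μ] fun x => (1 - x 1) * f (x 1) := by
    filter_upwards [ae_mem μ hμ 1] with x hx
    have : ∀ y, {x : ℕ → ℝ | x 1 < x 0}.indicator (fun x => f (x 1)) (Function.update x 0 y)
        = if x 1 < y then (fun _ => f (x 1)) y else (fun _ => (0:ℝ)) y := by
      intro y
      simp [Set.indicator_apply]
    simp_rw [this]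
    rw [int_split _ _ continuous_const continuous_const _ hx]
    simp
  have hi2 : Integrable (fun x : ℕ → ℝ => (1 - x 1) * f (x 1)) μ := by
    obtain ⟨C, hC⟩ := isCompact_Icc.exists_bound_of_continuousOn (s := Set.Icc (0:ℝ) 1)
      hc.continuousOn
    refine Integrable.mono' (integrable_const C)
      (hc.measurable.comp (measurable_pi_apply 1)).aestronglyMeasurable ?_
    filter_upwards [ae_mem μ hμ 1] with x hx
    exact hC _ hx
  rw [integral_resample μ hμ 0 _ hi, integral_congr_ae hae, integral_resample μ hμ 1 _ hi2]
  simp only [Function.update_self, integral_const, probReal_univ, one_smul]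
  unfold unifM
  rw [integral_Icc_eq_integral_Ioc, ← intervalIntegral.integral_of_le zero_le_one]

lemma Ph_zero : Ph 0 = {x : ℕ → ℝ | x 1 < x 0}.indicator (fun x => FF (x 1)) := by
  funext x
  by_cases h : x 1 < x 0
  · simp [Ph, AA, h, not_lt.2 h.le]
  · simp [Ph, AA, h]

lemma measure_B (μ : Measure (ℕ → ℝ)) (hμ : IsIIDUniform μ) :
    μ {x : ℕ → ℝ | x 1 < x 0} = 1 / 2 := by
  have := hμ.1
  have h := integral_first μ hμ (fun _ => 1) continuous_const
    ((integrable_const 1).indicator (meas_lt 1 0))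
  rw [integral_indicator (meas_lt 1 0)] at h
  have h2 : ∫ y in (0:ℝ)..1, (1 - y) * 1 = 1 / 2 := by
    simp only [mul_one]
    rw [intervalIntegral.integral_sub (by simp) (by simp)]
    simp
    norm_num
  rw [h2] at h
  simp only [integral_const, smul_eq_mul, mul_one, measureReal_restrict_apply_univ] at h
  rw [← ofReal_measureReal (measure_ne_top _ _), h]
  rw [ENNReal.ofReal_div_of_pos (by norm_num)]
  simp

theorem cond_exp_initial_21_to_123 (μ : Measure (ℕ → ℝ)) (hμ : IsIIDUniform μ)
    (B : Set (ℕ → ℝ)) (hB : B = {x | x 1 < x 0}) :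
    μ B = 1 / 2 ∧
    (1 / (μ B).toReal) *
        ∫ x in B, ((hitTime (1 : Equiv.Perm (Fin 3)) x : ℝ) - 2) ∂μ =
      Real.sqrt 3 * Real.tan (Real.sqrt 3 / 2 + Real.pi / 6) - 3 := by
  subst hB
  refine ⟨measure_B μ hμ, ?_⟩
  have hi := integrable_Ph μ hμ 0
  rw [Ph_zero] at hi
  rw [integral_T μ hμ, measure_B μ hμ, Ph_zero, integral_first μ hμ FF contF hi, int_last, F_zero]
  unfold cc ww
  simp only [one_div, ENNReal.toReal_inv, ENNReal.toReal_ofNat, inv_inv]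
  ring

end
end

section
/- Let k ≥ 3 and 2 ≤ i ≤ k−1. Let ι_k = 12⋯k ∈ S_k and let ρ ∈ S_k be the permutation 12⋯(i−1)(i+1)⋯ki, i.e., ρ_m = m for 1 ≤ m ≤ i−1, ρ_m = m+1 for i ≤ m ≤ k−1, and ρ_k = i. Then μ(T_{ι_k} < T_ρ) = 1/2. -/
open MeasureTheory ProbabilityTheory Real

noncomputable section

/-- The uniform measure on the unit interval. -/
def unif : Measure ℝ := (volume : Measure ℝ).restrict (Set.Icc 0 1)

instance unif_prob : IsProbabilityMeasure unif := ⟨by simp [unif]⟩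

lemma box_measure {μ : Measure (ℕ → ℝ)} (hμ : IsIIDUniform μ) (s : Finset ℕ) (t : ℕ → Set ℝ)
    (ht : ∀ i, MeasurableSet (t i)) :
    μ {x | ∀ i ∈ s, x i ∈ t i} = ∏ i ∈ s, unif (t i) := by
  classical
  obtain ⟨n, hn⟩ : ∃ n, s ⊆ Finset.range n := Finset.exists_nat_subset_range s
  have h := hμ.2 n
  have hset : {x : ℕ → ℝ | ∀ i ∈ s, x i ∈ t i} = (fun (x : ℕ → ℝ) (i : Fin n) => x i) ⁻¹'
      (Set.pi Set.univ (fun i : Fin n => if (i : ℕ) ∈ s then t i else Set.univ)) := by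
    ext x
    simp only [Set.mem_ofPred_eq, Set.mem_preimage, Set.mem_pi, Set.mem_univ, true_imp_iff]
    constructor
    · intro hx i
      split_ifs with hi
      · exact hx i hi
      · trivial
    · intro hx i hi
      have := hx ⟨i, Finset.mem_range.1 (hn hi)⟩
      simpa [hi] using this
  have hmeas : ∀ i : Fin n, MeasurableSet (if (i : ℕ) ∈ s then t i else Set.univ) := by
    intro i
    split_ifs
    · exact ht _
    · exact MeasurableSet.univ
  rw [hset, ← Measure.map_apply (by fun_prop) (MeasurableSet.univ_pi hmeas), h, Measure.pi_pi]
  change ∏ i : Fin n, unif _ = _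
  rw [Fin.prod_univ_eq_prod_range (fun i => unif (if i ∈ s then t i else Set.univ)) n,
    ← Finset.prod_subset hn]
  · exact Finset.prod_congr rfl fun i hi => by simp [hi]
  · intro i _ hi
    simp [hi]

lemma box_measure_inj {μ : Measure (ℕ → ℝ)} (hμ : IsIIDUniform μ) {ι : Type*} (s : Finset ι)
    (g : ι → ℕ) (hg : Function.Injective g) (t : ι → Set ℝ)
    (ht : ∀ i, MeasurableSet (t i)) :
    μ {x | ∀ i ∈ s, x (g i) ∈ t i} = ∏ i ∈ s, unif (t i) := by
  classical
  rcases isEmpty_or_nonempty ι with h | h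
  · have := box_measure hμ ∅ (fun _ => Set.univ) (by simp)
    rw [Finset.eq_empty_of_isEmpty s]
    simpa using this
  have := box_measure hμ (s.map ⟨g, hg⟩) (fun n => t (Function.invFun g n)) (fun n => ht _)
  simpa [Function.leftInverse_invFun hg _] using this

lemma perm_invariant {μ : Measure (ℕ → ℝ)} (hμ : IsIIDUniform μ) (e : Equiv.Perm ℕ) :
    MeasurePreserving (fun (x : ℕ → ℝ) n => x (e n)) μ μ := by
  have h1 : μ = Measure.infinitePi (fun _ : ℕ => unif) :=
    Measure.eq_infinitePi _ fun s t ht => box_measure hμ s t ht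
  have hm : Measurable (fun (x : ℕ → ℝ) n => x (e n)) := by fun_prop
  refine ⟨hm, ?_⟩
  conv_rhs => rw [h1]
  refine Measure.eq_infinitePi _ fun s t ht => ?_
  rw [Measure.map_apply hm (MeasurableSet.pi s.countable_toSet fun i _ => ht i)]
  exact box_measure_inj hμ s e e.injective t ht

lemma ae_occurs {μ : Measure (ℕ → ℝ)} (hμ : IsIIDUniform μ) {k : ℕ} (hk : 0 < k)
    (σ : Equiv.Perm (Fin k)) : ∀ᵐ x ∂μ, ∃ n, OccursAt σ x n := by
  have := hμ.1
  let I : Fin k → Set ℝ := fun a => Set.Ioo ((σ a : ℕ) / (k : ℝ)) (((σ a : ℕ) + 1) / (k : ℝ))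
  have hI : ∀ a, MeasurableSet (I a) := fun a => measurableSet_Ioo
  have hkr : (0 : ℝ) < k := by exact_mod_cast hk
  have hIpos : ∀ a, unif (I a) ≠ 0 := by
    intro a
    have hsub : I a ⊆ Set.Icc 0 1 := by
      intro y hy
      have h1 : ((σ a : ℕ) : ℝ) + 1 ≤ k := by exact_mod_cast (σ a).isLt
      refine ⟨le_trans (by positivity) hy.1.le, hy.2.le.trans ?_⟩
      rw [div_le_one hkr]
      exact h1
    rw [unif, Measure.restrict_apply (hI a), Set.inter_eq_self_of_subset_left hsub]
    simp only [I, Real.volume_Ioo]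
    simp only [ne_eq, ENNReal.ofReal_eq_zero, not_le, sub_pos]
    gcongr
    linarith
  let E : ℕ → Set (ℕ → ℝ) := fun j => {x | ∀ a : Fin k, x (j * k + a) ∈ I a}
  have hE : ∀ j, MeasurableSet (E j) := by
    intro j
    simp only [E, Set.ofPred_forall]
    exact MeasurableSet.iInter fun a => (measurable_pi_apply _) (hI a)
  let g : ℕ × Fin k → ℕ := fun p => p.1 * k + p.2
  have hg : Function.Injective g := by
    rintro ⟨j, a⟩ ⟨j', a'⟩ h
    simp only [g] at h
    have h1 : j = j' := by
      have := congrArg (· / k) h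
      simpa [Nat.mul_add_div hk, mul_comm _ k, Nat.div_eq_of_lt] using this
    subst h1
    simpa [Fin.ext_iff] using h
  have hbox : ∀ s : Finset ℕ, μ (⋂ j ∈ s, E j) = ∏ j ∈ s, ∏ a, unif (I a) := by
    intro s
    have h := box_measure_inj hμ (s ×ˢ Finset.univ) g hg (fun p => I p.2) (fun p => hI _)
    rw [Finset.prod_product] at h
    rw [← h]
    congr 1
    ext x
    simp only [E, g, Set.mem_iInter, Finset.mem_product, Finset.mem_univ, and_true, Prod.forall]
    exact ⟨fun h a b ha => h a ha b, fun h a ha b => h a b ha⟩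
  have hbox1 : ∀ j, μ (E j) = ∏ a, unif (I a) := by
    intro j
    simpa using hbox {j}
  have hind : iIndepSet E μ := by
    rw [iIndepSet_iff_meas_biInter hE]
    intro s
    rw [hbox s]
    simp [hbox1]
  have hlim := measure_limsup_eq_one hE hind (by
    simp only [hbox1]
    exact ENNReal.tsum_const_eq_top_of_ne_zero (Finset.prod_ne_zero_iff.2 fun a _ => hIpos a))
  have hae : ∀ᵐ x ∂μ, x ∈ Filter.limsup E Filter.atTop := by
    rw [← prob_compl_eq_zero_iff (MeasurableSet.measurableSet_limsup hE)] at hlim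
    exact hlim
  filter_upwards [hae] with x hx
  rw [Filter.mem_limsup_iff_frequently_mem] at hx
  obtain ⟨j, hj⟩ := hx.exists
  have key : ∀ a b : Fin k, σ a < σ b → x (j * k + a) < x (j * k + b) := by
    intro a b hab
    refine (hj a).2.trans (lt_of_le_of_lt ?_ (hj b).1)
    gcongr
    exact_mod_cast hab
  refine ⟨j * k, fun a b => ⟨fun h => ?_, key a b⟩⟩
  by_contra hn
  rcases (not_lt.1 hn).lt_or_eq with h1 | h1
  · exact lt_asymm h (key b a h1)
  · have := σ.injective h1
    subst this
    exact lt_irrefl _ h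

lemma measurableSet_occurs {k : ℕ} (σ : Equiv.Perm (Fin k)) (n : ℕ) :
    MeasurableSet {x | OccursAt σ x n} := by
  simp only [OccursAt, Set.ofPred_forall]
  refine MeasurableSet.iInter fun a => MeasurableSet.iInter fun b => ?_
  have h1 : MeasurableSet {x : ℕ → ℝ | x (n + a) < x (n + b)} :=
    measurableSet_lt (by fun_prop) (by fun_prop)
  by_cases h : σ a < σ b
  · simpa only [h, iff_true] using h1
  · simp only [h, iff_false]
    exact h1.compl

/-- `σ` occurs at `n`, and neither `σ` nor `τ` occurs before `n`. -/
def FirstAt {k : ℕ} (σ τ : Equiv.Perm (Fin k)) (x : ℕ → ℝ) (n : ℕ) : Prop :=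
  OccursAt σ x n ∧ ∀ m < n, ¬ OccursAt σ x m ∧ ¬ OccursAt τ x m

lemma measurableSet_first {k : ℕ} (σ τ : Equiv.Perm (Fin k)) (n : ℕ) :
    MeasurableSet {x | FirstAt σ τ x n} := by
  simp only [FirstAt, Set.ofPred_and, Set.ofPred_forall]
  refine (measurableSet_occurs σ n).inter (MeasurableSet.iInter fun m => MeasurableSet.iInter
    fun _ => (measurableSet_occurs σ m).compl.inter (measurableSet_occurs τ m).compl)

lemma hitTime_eq {k : ℕ} (σ : Equiv.Perm (Fin k)) (x : ℕ → ℝ) (n : ℕ) (hn : OccursAt σ x n)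
    (hm : ∀ m < n, ¬ OccursAt σ x m) : hitTime σ x = n + k := by
  refine IsLeast.csInf_eq ⟨⟨by omega, by simpa using hn⟩, ?_⟩
  rintro j ⟨h1, h2⟩
  by_contra h
  exact hm (j - k) (by omega) h2

lemma occurs_unique {k : ℕ} (σ τ : Equiv.Perm (Fin k)) (x : ℕ → ℝ) (n : ℕ)
    (h1 : OccursAt σ x n) (h2 : OccursAt τ x n) (a b : Fin k) : σ a < σ b ↔ τ a < τ b :=
  (h1 a b).symm.trans (h2 a b)

lemma hit_lt_iff {k : ℕ} (σ τ : Equiv.Perm (Fin k)) (x : ℕ → ℝ)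
    (hne : ∀ n, ¬ (OccursAt σ x n ∧ OccursAt τ x n))
    (hσ : ∃ n, OccursAt σ x n) (hτ : ∃ n, OccursAt τ x n) :
    hitTime σ x < hitTime τ x ↔ ∃ n, FirstAt σ τ x n := by
  classical
  have e1 := hitTime_eq σ x (Nat.find hσ) (Nat.find_spec hσ) (fun m hm => Nat.find_min hσ hm)
  have e2 := hitTime_eq τ x (Nat.find hτ) (Nat.find_spec hτ) (fun m hm => Nat.find_min hτ hm)
  rw [e1, e2, Nat.add_lt_add_iff_right]
  constructor
  · intro h
    exact ⟨_, Nat.find_spec hσ, fun m hm => ⟨Nat.find_min hσ hm, Nat.find_min hτ (hm.trans h)⟩⟩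
  · rintro ⟨n, hn, hm⟩
    have h1 : Nat.find hσ ≤ n := Nat.find_min' hσ hn
    have h2 : n ≤ Nat.find hτ := by
      by_contra h
      exact (hm _ (not_le.1 h)).2 (Nat.find_spec hτ)
    refine lt_of_le_of_ne (h1.trans h2) fun h => hne _ ⟨Nat.find_spec hσ, ?_⟩
    rw [h]
    exact Nat.find_spec hτ

lemma first_unique {k : ℕ} (σ τ : Equiv.Perm (Fin k)) (x : ℕ → ℝ) (m n : ℕ)
    (hm : FirstAt σ τ x m) (hn : FirstAt σ τ x n) : m = n := by
  rcases lt_trichotomy m n with h | h | h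
  · exact absurd hm.1 (hn.2 m h).1
  · exact h
  · exact absurd hn.1 (hm.2 n h).1

lemma measure_hit_lt {μ : Measure (ℕ → ℝ)} {k : ℕ} (σ τ : Equiv.Perm (Fin k))
    (hne : ∀ x n, ¬ (OccursAt σ x n ∧ OccursAt τ x n))
    (hσ : ∀ᵐ x ∂μ, ∃ n, OccursAt σ x n) (hτ : ∀ᵐ x ∂μ, ∃ n, OccursAt τ x n) :
    μ {x | hitTime σ x < hitTime τ x} = ∑' n, μ {x | FirstAt σ τ x n} := by
  rw [← measure_iUnion _ (measurableSet_first σ τ)]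
  · refine measure_congr ?_
    filter_upwards [hσ, hτ] with x h1 h2
    refine propext ?_
    have := hit_lt_iff σ τ x (hne x) h1 h2
    change hitTime σ x < hitTime τ x ↔ x ∈ ⋃ n, {x | FirstAt σ τ x n}
    simpa using this
  · intro m n hmn
    refine Set.disjoint_left.2 fun x hx hx' => hmn ?_
    exact first_unique σ τ x m n hx hx'

lemma occurs_one_iff {k : ℕ} (x : ℕ → ℝ) (n : ℕ) :
    OccursAt (1 : Equiv.Perm (Fin k)) x n ↔ ∀ a, a + 1 < k → x (n + a) < x (n + (a + 1)) := by
  constructor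
  · intro h a ha
    exact (h ⟨a, by omega⟩ ⟨a + 1, ha⟩).2 (by simp [Fin.lt_def])
  · intro h
    have key : ∀ b, b < k → ∀ a, a < b → x (n + a) < x (n + b) := by
      intro b
      induction b with
      | zero => intro _ a ha; omega
      | succ b ih =>
        intro hb a ha
        rcases Nat.lt_succ_iff_lt_or_eq.1 ha with h1 | h1
        · exact (ih (by omega) a h1).trans (h b hb)
        · subst h1; exact h a hb
    intro a b
    simp only [Equiv.Perm.one_apply]
    refine ⟨fun hab => ?_, fun hab => key b b.isLt a hab⟩
    by_contra hn
    rcases (not_lt.1 hn).lt_or_eq with h1 | h1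
    · exact lt_asymm hab (key a a.isLt b h1)
    · subst h1; exact lt_irrefl _ hab

/-- The function on `ℕ` that applies `σ` to the window of length `k` starting at `n`. -/
def winFun {k : ℕ} (σ : Equiv.Perm (Fin k)) (n j : ℕ) : ℕ :=
  if h : n ≤ j ∧ j < n + k then n + σ ⟨j - n, by omega⟩ else j

lemma winFun_in {k : ℕ} (σ : Equiv.Perm (Fin k)) (n : ℕ) (a : Fin k) :
    winFun σ n (n + a) = n + σ a := by
  have := a.isLt
  simp [winFun]

lemma winFun_out {k : ℕ} (σ : Equiv.Perm (Fin k)) (n j : ℕ) (h : ¬ (n ≤ j ∧ j < n + k)) :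
    winFun σ n j = j := by
  simp only [winFun, dif_neg h]

lemma winFun_inv {k : ℕ} (σ τ : Equiv.Perm (Fin k)) (hστ : ∀ a, σ (τ a) = a) (n j : ℕ) :
    winFun σ n (winFun τ n j) = j := by
  by_cases h : n ≤ j ∧ j < n + k
  · obtain ⟨a, rfl⟩ : ∃ a : Fin k, j = n + a := ⟨⟨j - n, by omega⟩, by simp; omega⟩
    rw [winFun_in, winFun_in, hστ]
  · rw [winFun_out τ n j h, winFun_out σ n j h]

/-- `winFun` as a permutation. -/
def winPerm {k : ℕ} (σ : Equiv.Perm (Fin k)) (n : ℕ) : Equiv.Perm ℕ where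
  toFun := winFun σ n
  invFun := winFun σ⁻¹ n
  left_inv := winFun_inv _ _ (by simp) n
  right_inv := winFun_inv _ _ (by simp) n

lemma first_iff {k i : ℕ} (hk : 3 ≤ k) (hi1 : 2 ≤ i) (hi2 : i ≤ k - 1)
    (ρ : Equiv.Perm (Fin k))
    (hρ : ∀ a : Fin k, (ρ a : ℕ) =
      if (a : ℕ) < i - 1 then (a : ℕ) else if (a : ℕ) < k - 1 then (a : ℕ) + 1 else i - 1)
    (x : ℕ → ℝ) (n : ℕ) :
    FirstAt 1 ρ x n ↔ FirstAt ρ 1 (fun j => x (winFun ρ n j)) n := by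
  set y : ℕ → ℝ := fun j => x (winFun ρ n j) with hy
  have hyin : ∀ a : Fin k, y (n + a) = x (n + ρ a) := fun a => by simp only [hy, winFun_in]
  have hyout : ∀ j, j ≤ n → y j = x j := by
    intro j hj
    rcases hj.lt_or_eq with h | h
    · simp only [hy]
      rw [winFun_out _ _ _ (by omega)]
    · subst h
      have h0 : ((ρ ⟨0, by omega⟩ : Fin k) : ℕ) = 0 := by
        rw [hρ]; simp; omega
      have := hyin ⟨0, by omega⟩
      rw [h0] at this
      simpa using this
  have hocc : OccursAt (1 : Equiv.Perm (Fin k)) x n ↔ OccursAt ρ y n := by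
    constructor
    · intro h a b
      rw [hyin, hyin]
      exact h (ρ a) (ρ b)
    · intro h a b
      have := h (ρ⁻¹ a) (ρ⁻¹ b)
      rw [hyin, hyin] at this
      simpa using this
  unfold FirstAt
  rw [← hocc]
  refine and_congr_right fun h1 => forall_congr' fun m => forall_congr' fun hm => ?_
  have hxa : ∀ a, a + 2 < k → x (n + a) < x (n + (a + 1)) := fun a ha =>
    (occurs_one_iff x n).1 h1 a (by omega)
  have hya : ∀ a, a + 2 < k → y (n + a) < y (n + (a + 1)) := by
    intro a ha
    refine ((hocc.1 h1) ⟨a, by omega⟩ ⟨a + 1, by omega⟩).2 ?_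
    rw [Fin.lt_def, hρ, hρ]
    simp only
    split_ifs <;> omega
  have hstep : ∀ j, j + 2 < n + k → (x j < x (j + 1) ↔ y j < y (j + 1)) := by
    intro j hj
    by_cases h : j + 1 ≤ n
    · rw [hyout _ h, hyout j (by omega)]
    · obtain ⟨a, rfl⟩ : ∃ a, j = n + a := ⟨j - n, by omega⟩
      exact iff_of_true (hxa a (by omega)) (hya a (by omega))
  have e1 : OccursAt (1 : Equiv.Perm (Fin k)) x m ↔ OccursAt (1 : Equiv.Perm (Fin k)) y m := by
    rw [occurs_one_iff, occurs_one_iff]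
    refine forall_congr' fun a => forall_congr' fun ha => ?_
    exact hstep (m + a) (by omega)
  have e2 : OccursAt ρ x m ↔ OccursAt ρ y m := by
    by_cases h : m + k ≤ n + 1
    · refine forall_congr' fun a => forall_congr' fun b => ?_
      have := a.isLt
      have := b.isLt
      rw [hyout _ (by omega), hyout _ (by omega)]
    · have hdesc : ∀ z : ℕ → ℝ, (∀ a, a + 2 < k → z (n + a) < z (n + (a + 1))) →
          ¬ OccursAt ρ z m := by
        intro z hz ho
        have h2 := hz (m + k - 2 - n) (by omega)
        have h3 := (ho ⟨k - 2, by omega⟩ ⟨k - 1, by omega⟩).1 (by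
          simp only
          convert h2 using 2 <;> omega)
        rw [Fin.lt_def, hρ, hρ] at h3
        simp only at h3
        split_ifs at h3 <;> omega
      exact iff_of_false (hdesc x hxa) (hdesc y hya)
  rw [e1, e2, and_comm]

theorem iota_tie_rho (μ : Measure (ℕ → ℝ)) (hμ : IsIIDUniform μ)
    (k i : ℕ) (hk : 3 ≤ k) (hi1 : 2 ≤ i) (hi2 : i ≤ k - 1)
    (ρ : Equiv.Perm (Fin k))
    (hρ : ∀ a : Fin k, (ρ a : ℕ) =
      if (a : ℕ) < i - 1 then (a : ℕ) else if (a : ℕ) < k - 1 then (a : ℕ) + 1 else i - 1) :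
    μ {x | hitTime (1 : Equiv.Perm (Fin k)) x < hitTime ρ x} = 1 / 2 := by
  have := hμ.1
  have hne : ∀ x n, ¬ (OccursAt (1 : Equiv.Perm (Fin k)) x n ∧ OccursAt ρ x n) := by
    rintro x n ⟨h1, h2⟩
    have h := (occurs_unique _ _ x n h1 h2 ⟨k - 2, by omega⟩ ⟨k - 1, by omega⟩).1 (by
      simp only [Equiv.Perm.one_apply, Fin.lt_def]; omega)
    rw [Fin.lt_def, hρ, hρ] at h
    simp only at h
    split_ifs at h <;> omega
  have o1 := ae_occurs hμ (by omega) (1 : Equiv.Perm (Fin k))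
  have o2 := ae_occurs hμ (by omega) ρ
  have m1 := measure_hit_lt (μ := μ) 1 ρ hne o1 o2
  have m2 := measure_hit_lt (μ := μ) ρ 1 (fun x n h => hne x n h.symm) o2 o1
  have heq : μ {x | hitTime (1 : Equiv.Perm (Fin k)) x < hitTime ρ x} =
      μ {x | hitTime ρ x < hitTime (1 : Equiv.Perm (Fin k)) x} := by
    rw [m1, m2]
    refine tsum_congr fun n => ?_
    have hp := (perm_invariant hμ (winPerm ρ n)).measure_preimage
      (measurableSet_first ρ 1 n).nullMeasurableSet
    rw [← hp]
    congr 1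
    ext x
    exact first_iff hk hi1 hi2 ρ hρ x n
  have hmeas : NullMeasurableSet {x | hitTime ρ x < hitTime (1 : Equiv.Perm (Fin k)) x} μ := by
    refine NullMeasurableSet.congr
      (MeasurableSet.iUnion (measurableSet_first ρ 1)).nullMeasurableSet ?_
    filter_upwards [o1, o2] with x h1 h2
    refine propext ?_
    change x ∈ ⋃ n, {x | FirstAt ρ 1 x n} ↔ hitTime ρ x < hitTime 1 x
    simpa using (hit_lt_iff ρ 1 x (fun n h => hne x n h.symm) h2 h1).symm
  have hcompl : μ {x | hitTime (1 : Equiv.Perm (Fin k)) x < hitTime ρ x} =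
      μ {x | hitTime ρ x < hitTime (1 : Equiv.Perm (Fin k)) x}ᶜ := by
    refine measure_congr ?_
    filter_upwards [o1, o2] with x h1 h2
    refine propext ?_
    change hitTime 1 x < hitTime ρ x ↔ ¬ (hitTime ρ x < hitTime 1 x)
    classical
    have e1 := hitTime_eq 1 x (Nat.find h1) (Nat.find_spec h1) (fun m hm => Nat.find_min h1 hm)
    have e2 := hitTime_eq ρ x (Nat.find h2) (Nat.find_spec h2) (fun m hm => Nat.find_min h2 hm)
    have h3 : Nat.find h1 ≠ Nat.find h2 := by
      intro h
      refine hne x _ ⟨Nat.find_spec h1, ?_⟩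
      rw [h]
      exact Nat.find_spec h2
    rw [e1, e2]
    omega
  have hsum := measure_add_measure_compl₀ hmeas
  rw [← hcompl, ← heq, measure_univ, ← two_mul] at hsum
  rw [ENNReal.eq_div_iff (by simp) (by simp)]
  exact hsum

end
end

section
/- For every n ≥ 3, the number of permutations π ∈ S_n such that st(π_{n−2}π_{n−1}π_n) = 132, π has no consecutive occurrence of 132 other than this final window, and π has no consecutive occurrence of 231, equals 2^{n−1} − n. -/
open MeasureTheory ProbabilityTheory Real

noncomputable section

theorem occ132 {n : ℕ} (σ : Equiv.Perm (Fin 3)) (hσ : σ 0 = 0 ∧ σ 1 = 2 ∧ σ 2 = 1)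
    (p : Equiv.Perm (Fin n)) (i : ℕ) :
    PermOccursAt σ p i ↔ ∃ h : i + 2 < n,
      p ⟨i, by omega⟩ < p ⟨i + 2, h⟩ ∧ p ⟨i + 2, h⟩ < p ⟨i + 1, by omega⟩ := by
  obtain ⟨h0, h1, h2⟩ := hσ
  constructor
  · rintro ⟨h, H⟩
    refine ⟨by omega, ?_, ?_⟩
    · exact (H 0 2).2 (by rw [h0, h2]; decide)
    · exact (H 2 1).2 (by rw [h1, h2]; decide)
  · rintro ⟨h, H1, H2⟩
    refine ⟨by omega, ?_⟩
    have H3 := H1.trans H2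
    intro a b
    fin_cases a <;> fin_cases b <;> simp [h0, h1, h2] <;>
      first | exact H1 | exact H2 | exact H3 | exact H1.le | exact H2.le | exact H3.le

theorem occ231 {n : ℕ} (σ : Equiv.Perm (Fin 3)) (hσ : σ 0 = 1 ∧ σ 1 = 2 ∧ σ 2 = 0)
    (p : Equiv.Perm (Fin n)) (i : ℕ) :
    PermOccursAt σ p i ↔ ∃ h : i + 2 < n,
      p ⟨i + 2, h⟩ < p ⟨i, by omega⟩ ∧ p ⟨i, by omega⟩ < p ⟨i + 1, by omega⟩ := by
  obtain ⟨h0, h1, h2⟩ := hσ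
  constructor
  · rintro ⟨h, H⟩
    refine ⟨by omega, ?_, ?_⟩
    · exact (H 2 0).2 (by rw [h0, h2]; decide)
    · exact (H 0 1).2 (by rw [h1, h0]; decide)
  · rintro ⟨h, H1, H2⟩
    refine ⟨by omega, ?_⟩
    have H3 := H1.trans H2
    intro a b
    fin_cases a <;> fin_cases b <;> simp [h0, h1, h2] <;>
      first | exact H1 | exact H2 | exact H3 | exact H1.le | exact H2.le | exact H3.le

/-- No interior peak, and the ascent at position `k` (hence the last three entries increase). -/
def GoodV (k : ℕ) (q : Equiv.Perm (Fin (k + 3))) : Prop :=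
  (∀ i (h : i + 2 < k + 3), q ⟨i, by omega⟩ < q ⟨i + 1, by omega⟩ →
    q ⟨i + 1, by omega⟩ < q ⟨i + 2, h⟩) ∧
  q ⟨k, by omega⟩ < q ⟨k + 1, by omega⟩

def keyC (k : ℕ) (C : Finset (Fin (k + 2))) : Fin (k + 3) → ℤ :=
  Fin.cases 0 (fun w => if w ∈ C then ((w : ℕ) : ℤ) + 1 else -(((w : ℕ) : ℤ) + 1))

theorem keyC_zero (k : ℕ) (C : Finset (Fin (k + 2))) : keyC k C 0 = 0 := rfl

theorem keyC_succ (k : ℕ) (C : Finset (Fin (k + 2))) (w : Fin (k + 2)) :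
    keyC k C w.succ = if w ∈ C then ((w : ℕ) : ℤ) + 1 else -(((w : ℕ) : ℤ) + 1) := rfl

theorem keyC_abs (k : ℕ) (C : Finset (Fin (k + 2))) (v : Fin (k + 3)) :
    keyC k C v = (v : ℕ) ∨ keyC k C v = -(v : ℕ) := by
  refine Fin.cases ?_ (fun w => ?_) v
  · simp [keyC_zero]
  · rw [keyC_succ]; split_ifs <;> simp

theorem keyC_inj (k : ℕ) (C : Finset (Fin (k + 2))) : Function.Injective (keyC k C) := by
  intro a b
  refine Fin.cases ?_ (fun w => ?_) a <;> refine Fin.cases ?_ (fun w' => ?_) b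
  · simp
  · rw [keyC_zero, keyC_succ]; split_ifs <;> intro h <;> omega
  · rw [keyC_zero, keyC_succ]; split_ifs <;> intro h <;> omega
  · rw [keyC_succ, keyC_succ]; split_ifs <;> intro h <;> rw [Fin.succ_inj] <;> ext <;> omega

def invC (k : ℕ) (q : Equiv.Perm (Fin (k + 3))) : Finset (Fin (k + 2)) :=
  Finset.univ.filter (fun w => q.symm 0 < q.symm w.succ)

theorem mem_invC (k : ℕ) (q : Equiv.Perm (Fin (k + 3))) (w : Fin (k + 2)) :
    w ∈ invC k q ↔ q.symm 0 < q.symm w.succ := by simp [invC]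

theorem eq_invC (k : ℕ) (C : Finset (Fin (k + 2))) (q : Equiv.Perm (Fin (k + 3)))
    (h : StrictMono (keyC k C ∘ q)) : C = invC k q := by
  ext w
  rw [mem_invC, ← h.lt_iff_lt]
  simp only [Function.comp, Equiv.apply_symm_apply, keyC_zero, keyC_succ]
  split_ifs with hw <;> simp only [hw, true_iff, false_iff] <;> omega

theorem card_invC (k : ℕ) (q : Equiv.Perm (Fin (k + 3))) :
    (invC k q).card + (q.symm 0 : ℕ) = k + 2 := by
  have : (invC k q).card = (Finset.Ioi (q.symm 0)).card := by
    refine Finset.card_bij (fun w _ => q.symm w.succ) ?_ ?_ ?_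
    · intro w hw; simpa [mem_invC] using hw
    · intro a _ b _ h; simpa using h
    · intro b hb
      rw [Finset.mem_Ioi] at hb
      have hne : q b ≠ 0 := by
        rintro h0
        rw [← h0] at hb; simp at hb
      obtain ⟨w, hw⟩ := Fin.exists_succ_eq.2 hne
      refine ⟨w, ?_, ?_⟩
      · rw [mem_invC, hw]; simpa using hb
      · simp [hw]
  rw [this, Fin.card_Ioi]
  have := (q.symm 0).isLt
  omega

theorem noPeak_of_key (k : ℕ) (C : Finset (Fin (k + 2))) (q : Equiv.Perm (Fin (k + 3)))
    (h : StrictMono (keyC k C ∘ q)) (i : ℕ) (hi : i + 2 < k + 3)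
    (h1 : q ⟨i, by omega⟩ < q ⟨i + 1, by omega⟩) :
    q ⟨i + 1, by omega⟩ < q ⟨i + 2, hi⟩ := by
  have a1 : keyC k C (q ⟨i, by omega⟩) < keyC k C (q ⟨i + 1, by omega⟩) :=
    h (by simp [Fin.lt_def])
  have a2 : keyC k C (q ⟨i + 1, by omega⟩) < keyC k C (q ⟨i + 2, hi⟩) :=
    h (by simp [Fin.lt_def])
  have b0 := keyC_abs k C (q ⟨i, by omega⟩)
  have b1 := keyC_abs k C (q ⟨i + 1, by omega⟩)
  have b2 := keyC_abs k C (q ⟨i + 2, hi⟩)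
  rw [Fin.lt_def] at *
  omega

theorem asc_prop (k : ℕ) (q : Equiv.Perm (Fin (k + 3))) (hq : GoodV k q) (i j : ℕ) (hij : i ≤ j)
    (hj : j + 1 < k + 3) (h1 : q ⟨i, by omega⟩ < q ⟨i + 1, by omega⟩) :
    q ⟨j, by omega⟩ < q ⟨j + 1, hj⟩ := by
  induction j, hij using Nat.le_induction with
  | base => exact h1
  | succ j hij ih => exact hq.1 j hj (ih (by omega) h1)

theorem keyC_inv (k : ℕ) (q : Equiv.Perm (Fin (k + 3))) (i : Fin (k + 3)) :
    keyC k (invC k q) (q i) = if q.symm 0 ≤ i then ((q i : ℕ) : ℤ) else -((q i : ℕ) : ℤ) := by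
  rcases Fin.eq_zero_or_eq_succ (q i) with h | ⟨w, hw⟩
  · rw [h, keyC_zero]; simp
  · have hi : i = q.symm w.succ := by rw [← hw]; simp
    have hne : q.symm 0 ≠ i := by
      rw [hi]; intro h
      exact Fin.succ_ne_zero w (q.symm.injective h).symm
    have hiff : w ∈ invC k q ↔ q.symm 0 ≤ i := by
      rw [mem_invC, ← hi, le_iff_lt_or_eq, or_iff_left hne]
    rw [hw, keyC_succ]
    simp only [hiff, Fin.val_succ, Nat.cast_add, Nat.cast_one]

theorem key_of_good (k : ℕ) (q : Equiv.Perm (Fin (k + 3))) (hq : GoodV k q) :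
    StrictMono (keyC k (invC k q) ∘ q) := by
  rw [Fin.strictMono_iff_lt_succ]
  rintro ⟨i, hi⟩
  simp only [Function.comp, keyC_inv, Fin.castSucc_mk, Fin.succ_mk]
  have hm0 : q (q.symm 0) = 0 := by simp
  obtain ⟨m, hm⟩ : ∃ m, m = q.symm 0 := ⟨_, rfl⟩
  rw [← hm] at hm0 ⊢
  obtain ⟨m, hlt⟩ := m
  have hne : q ⟨i, by omega⟩ ≠ q ⟨i + 1, by omega⟩ := by
    intro h; have := q.injective h; simp at this
  have hpos : ∀ j (hj : j < k + 3), j ≠ m → 0 < (q ⟨j, hj⟩ : ℕ) := by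
    intro j hj hjm
    rcases Nat.eq_zero_or_pos (q ⟨j, hj⟩ : ℕ) with h | h
    · exfalso; apply hjm
      have : q ⟨j, hj⟩ = q ⟨m, hlt⟩ := by rw [hm0]; ext; simpa using h
      simpa using q.injective this
    · exact h
  simp only [Fin.mk_le_mk]
  by_cases him : m ≤ i
  · rw [if_pos him, if_pos (by omega)]
    have := asc_prop k q hq m i him (by omega) (by
      rw [hm0, Fin.lt_def]; exact hpos _ _ (by omega))
    rw [Fin.lt_def] at this
    exact_mod_cast this
  · have hdesc : q ⟨i + 1, by omega⟩ < q ⟨i, by omega⟩ := by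
      by_contra hcon
      have hasc : q ⟨i, by omega⟩ < q ⟨i + 1, by omega⟩ := lt_of_le_of_ne (not_lt.1 hcon) hne
      obtain ⟨m', rfl⟩ : ∃ m', m = m' + 1 := ⟨m - 1, by omega⟩
      have := asc_prop k q hq i m' (by omega) hlt hasc
      rw [hm0] at this
      exact absurd this (Fin.not_lt_zero _)
    have hp := hpos i (by omega) (by omega)
    rw [Fin.lt_def] at hdesc
    rw [if_neg him]
    split_ifs <;> omega

theorem inv_card_of_good (k : ℕ) (q : Equiv.Perm (Fin (k + 3))) (hq : GoodV k q) :
    2 ≤ (invC k q).card := by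
  have h := card_invC k q
  have h1 := asc_prop k q hq k (k + 1) (by omega) (by omega) hq.2
  have h0 := hq.2
  by_contra hc
  have hm0 : q (q.symm 0) = 0 := by simp
  obtain ⟨m, hm⟩ : ∃ m, m = q.symm 0 := ⟨_, rfl⟩
  rw [← hm] at hm0 h
  obtain ⟨m, hlt⟩ := m
  simp only at h
  have : m = k + 1 ∨ m = k + 2 := by omega
  rcases this with rfl | rfl
  · rw [hm0] at h0; exact absurd h0 (Fin.not_lt_zero _)
  · rw [hm0] at h1; exact absurd h1 (Fin.not_lt_zero _)

theorem good_of_key (k : ℕ) (C : Finset (Fin (k + 2))) (hC : 2 ≤ C.card)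
    (q : Equiv.Perm (Fin (k + 3))) (h : StrictMono (keyC k C ∘ q)) : GoodV k q := by
  refine ⟨noPeak_of_key k C q h, ?_⟩
  have hinv := eq_invC k C q h
  have hc := card_invC k q
  rw [← hinv] at hc
  have a1 : keyC k C (q ⟨k, by omega⟩) < keyC k C (q ⟨k + 1, by omega⟩) :=
    h (by simp [Fin.lt_def])
  rw [hinv, keyC_inv, keyC_inv, if_pos (by rw [Fin.le_def]; simp only; omega),
    if_pos (by rw [Fin.le_def]; simp only; omega)] at a1
  rw [Fin.lt_def]
  exact_mod_cast a1

theorem card_good (k : ℕ) :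
    Nat.card {q : Equiv.Perm (Fin (k + 3)) // GoodV k q} =
      Nat.card {C : Finset (Fin (k + 2)) // 2 ≤ C.card} := by
  refine Nat.card_eq_of_bijective
    (fun q => (⟨invC k q.1, inv_card_of_good k q.1 q.2⟩ : {C : Finset (Fin (k + 2)) // 2 ≤ C.card}))
    ⟨?_, ?_⟩
  · rintro ⟨q, hq⟩ ⟨q', hq'⟩ h
    simp only [Subtype.mk.injEq] at h ⊢
    have h1 := key_of_good k q hq
    have h2 := key_of_good k q' hq'
    rw [← h] at h2
    have := Tuple.unique_monotone h1.monotone h2.monotone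
    ext x
    have := keyC_inj k _ (congrFun this x)
    rw [this]
  · rintro ⟨C, hC⟩
    have hs : StrictMono (keyC k C ∘ Tuple.sort (keyC k C)) :=
      (Tuple.monotone_sort _).strictMono_of_injective
        ((keyC_inj k C).comp (Equiv.injective _))
    exact ⟨⟨_, good_of_key k C hC _ hs⟩, Subtype.ext (eq_invC k C _ hs).symm⟩

theorem card_two_le (m : ℕ) :
    Nat.card {C : Finset (Fin m) // 2 ≤ C.card} = 2 ^ m - (m + 1) := by
  rw [Nat.card_eq_fintype_card, Fintype.card_subtype]
  have h := Finset.card_filter_add_card_filter_not (s := (Finset.univ : Finset (Finset (Fin m))))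
    (fun C => 2 ≤ C.card)
  have h2 : (Finset.univ.filter (fun C : Finset (Fin m) => ¬ 2 ≤ C.card)) =
      Finset.powersetCard 0 Finset.univ ∪ Finset.powersetCard 1 Finset.univ := by
    ext C
    simp only [Finset.mem_filter, Finset.mem_univ, true_and, Finset.mem_union,
      Finset.mem_powersetCard, Finset.subset_univ]
    omega
  rw [h2, Finset.card_union_of_disjoint, Finset.card_powersetCard, Finset.card_powersetCard] at h
  · simp at h ⊢
    omega
  · exact Finset.pairwise_disjoint_powersetCard _ (by decide)

theorem cond_iff (k : ℕ) (p : Equiv.Perm (Fin (k + 3))) (σ τ : Equiv.Perm (Fin 3))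
    (hσ : σ 0 = 0 ∧ σ 1 = 2 ∧ σ 2 = 1)
    (hτ : τ 0 = 1 ∧ τ 1 = 2 ∧ τ 2 = 0) :
    (PermOccursAt σ p k ∧ (∀ i, PermOccursAt σ p i → i = k) ∧ (∀ i, ¬ PermOccursAt τ p i)) ↔
    GoodV k (p * Equiv.swap ⟨k + 1, by omega⟩ ⟨k + 2, by omega⟩) := by
  simp only [occ132 σ hσ, occ231 τ hτ]
  have s1 : Equiv.swap (⟨k + 1, by omega⟩ : Fin (k + 3)) ⟨k + 2, by omega⟩ ⟨k + 1, by omega⟩ =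
    ⟨k + 2, by omega⟩ := Equiv.swap_apply_left _ _
  have s2 : Equiv.swap (⟨k + 1, by omega⟩ : Fin (k + 3)) ⟨k + 2, by omega⟩ ⟨k + 2, by omega⟩ =
    ⟨k + 1, by omega⟩ := Equiv.swap_apply_right _ _
  have s0 : ∀ i (hi : i ≤ k), Equiv.swap (⟨k + 1, by omega⟩ : Fin (k + 3)) ⟨k + 2, by omega⟩
      ⟨i, by omega⟩ = ⟨i, by omega⟩ := fun i hi =>
    Equiv.swap_apply_of_ne_of_ne (by simp; omega) (by simp; omega)
  unfold GoodV
  simp only [Equiv.Perm.mul_apply]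
  constructor
  · rintro ⟨⟨_, h1, h2⟩, h3, h4⟩
    refine ⟨?_, ?_⟩
    · intro i hi
      have hcase : i = k ∨ i + 1 = k ∨ i + 2 ≤ k := by omega
      rcases hcase with rfl | rfl | hik
      · rw [s1, s2]; intro _; exact h2
      · rw [s0 (i + 1) le_rfl, s1]; intro _; exact h1
      · rw [s0 i (by omega), s0 (i + 1) (by omega), s0 (i + 2) hik]
        intro ha
        by_contra hb
        have hne : p ⟨i + 1, by omega⟩ ≠ p ⟨i + 2, hi⟩ := by
          intro h; have := p.injective h; simp at this
        have hne' : p ⟨i, by omega⟩ ≠ p ⟨i + 2, hi⟩ := by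
          intro h; have := p.injective h; simp at this
        have hb' := lt_of_le_of_ne (not_lt.1 hb) hne.symm
        rcases lt_or_gt_of_ne hne' with h | h
        · have := h3 i ⟨hi, h, hb'⟩; omega
        · exact h4 i ⟨hi, h, ha⟩
    · rw [s0 k le_rfl, s1]; exact h1
  · rintro ⟨h1, h2⟩
    have h3 := h1 k (by omega) h2
    rw [s0 k le_rfl, s1] at h2
    rw [s1, s2] at h3
    have main : ∀ i (hi : i + 2 < k + 3), i ≠ k → p ⟨i, by omega⟩ < p ⟨i + 1, by omega⟩ →
        p ⟨i + 1, by omega⟩ < p ⟨i + 2, hi⟩ := by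
      intro i hi hik ha
      have hcase : i + 1 = k ∨ i + 2 ≤ k := by omega
      rcases hcase with rfl | hik
      · exact h2.trans h3
      · have := h1 i hi
        rw [s0 i (by omega), s0 (i + 1) (by omega), s0 (i + 2) hik] at this
        exact this ha
    refine ⟨⟨by omega, h2, h3⟩, ?_, ?_⟩
    · rintro i ⟨hi, ha, hb⟩
      by_contra hik
      exact lt_asymm hb (main i hi hik (ha.trans hb))
    · rintro i ⟨hi, ha, hb⟩
      by_cases hik : i = k
      · subst hik; exact lt_asymm ha h2
      · exact lt_asymm (ha.trans hb) (main i hi hik hb)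

theorem count_end132_avoid_132_231 (n : ℕ) (hn : 3 ≤ n)
    (σ τ : Equiv.Perm (Fin 3))
    (hσ : σ 0 = 0 ∧ σ 1 = 2 ∧ σ 2 = 1)
    (hτ : τ 0 = 1 ∧ τ 1 = 2 ∧ τ 2 = 0) :
    Nat.card {p : Equiv.Perm (Fin n) //
      PermOccursAt σ p (n - 3) ∧
      (∀ i, PermOccursAt σ p i → i = n - 3) ∧
      (∀ i, ¬ PermOccursAt τ p i)} = 2 ^ (n - 1) - n := by
  obtain ⟨k, rfl⟩ : ∃ k, n = k + 3 := ⟨n - 3, by omega⟩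
  have e : k + 3 - 3 = k := by omega
  rw [e, show k + 3 - 1 = k + 2 by omega, ← card_two_le (k + 2), ← card_good k]
  exact Nat.card_congr (Equiv.subtypeEquiv (Equiv.mulRight _)
    (fun p => cond_iff k p σ τ hσ hτ))

end
end

section
/- Let 2134 and 3241 denote the corresponding patterns in S_4 (in one-line notation). Then μ(T_{2134} < T_{3241}) = 1/2. -/
open MeasureTheory ProbabilityTheory Real

noncomputable section

namespace Tie

/-- Uniform law on [0,1]. -/
def lam : Measure ℝ := (volume : Measure ℝ).restrict (Set.Icc 0 1)

instance : IsProbabilityMeasure lam := ⟨by simp [lam]⟩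

theorem eq_inf (μ : Measure (ℕ → ℝ)) (hμ : IsIIDUniform μ) :
    μ = Measure.infinitePi (fun _ : ℕ => lam) := by
  classical
  refine Measure.eq_infinitePi _ fun s t ht => ?_
  set N := s.sup id + 1 with hN
  have hs : s ⊆ Finset.range N := by
    intro i hi
    have : i ≤ s.sup id := Finset.le_sup (f := id) hi
    simp [hN]; omega
  have h := hμ.2 N
  have e : Set.pi (s : Set ℕ) t = (fun (x : ℕ → ℝ) (i : Fin N) => x i) ⁻¹'
      (Set.univ.pi (fun i : Fin N => if (i : ℕ) ∈ s then t i else Set.univ)) := by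
    ext x
    simp only [Set.mem_pi, Finset.mem_coe, Set.mem_preimage, Set.mem_univ, true_imp_iff]
    constructor
    · intro hx i
      split_ifs with hi
      · exact hx i hi
      · trivial
    · intro hx i hi
      have := hx ⟨i, by simpa using hs hi⟩
      simpa [hi] using this
  rw [e, ← Measure.map_apply (by fun_prop), h, Measure.pi_pi]
  · rw [Fin.prod_univ_eq_prod_range (fun i => (volume.restrict (Set.Icc (0:ℝ) 1)) (if i ∈ s then t i else Set.univ)) N]
    rw [← Finset.prod_subset hs]
    · apply Finset.prod_congr rfl
      intro i hi
      simp [hi, lam]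
    · intro i _ hi
      simp [hi]
  · refine MeasurableSet.univ_pi fun i => ?_
    split_ifs
    · exact ht _
    · exact MeasurableSet.univ

/-- Product law. -/
abbrev mm : Measure (ℕ → ℝ) := Measure.infinitePi (fun _ : ℕ => lam)

theorem resample_map (n : ℕ) :
    (mm.prod lam).map (fun p : (ℕ → ℝ) × ℝ => Function.update p.1 n p.2) = mm := by
  classical
  refine Measure.eq_infinitePi _ fun s t ht => ?_
  rw [Measure.map_apply measurable_update' (.pi s.countable_toSet fun _ _ => ht _)]
  have e : (fun p : (ℕ → ℝ) × ℝ => Function.update p.1 n p.2) ⁻¹' (Set.pi (s : Set ℕ) t)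
     = (Set.pi ((s.erase n : Finset ℕ) : Set ℕ) t) ×ˢ (if n ∈ s then t n else Set.univ) := by
    ext ⟨x, y⟩
    simp only [Set.mem_preimage, Set.mem_pi, Finset.mem_coe, Set.mem_prod, Finset.mem_erase]
    constructor
    · intro h
      refine ⟨fun i hi => by simpa [hi.1] using h i hi.2, ?_⟩
      split_ifs with hn
      · simpa using h n hn
      · trivial
    · rintro ⟨h1, h2⟩ i hi
      by_cases hin : i = n
      · subst hin; simpa [hi] using h2
      · simpa [hin] using h1 i ⟨hin, hi⟩
  rw [e, Measure.prod_prod, Measure.infinitePi_pi _ (fun i _ => ht i)]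
  split_ifs with hn
  · rw [Finset.prod_erase_mul _ _ hn]
  · simp [Finset.erase_eq_of_notMem hn]

theorem resample (n : ℕ) (f : (ℕ → ℝ) → ℝ → ENNReal) (hf : Measurable (Function.uncurry f))
    (hi : ∀ x y z, f (Function.update x n y) z = f x z) :
    ∫⁻ x, f x (x n) ∂mm = ∫⁻ x, ∫⁻ y, f x y ∂lam ∂mm := by
  have hm : Measurable (fun x : ℕ → ℝ => f x (x n)) :=
    hf.comp (measurable_id.prodMk (measurable_pi_apply n))
  conv_lhs => rw [← resample_map n]
  rw [lintegral_map hm measurable_update', lintegral_prod]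
  · simp [hi]
  · exact (hm.comp measurable_update').aemeasurable

theorem lam_refl : lam.map (fun y => 1 - y) = lam := by
  have h : MeasurePreserving (fun y : ℝ => 1 - y) volume volume :=
    Measure.measurePreserving_sub_left volume 1
  have := (h.restrict_preimage (measurableSet_Icc (a := (0:ℝ)) (b := 1))).map_eq
  have e : (fun y : ℝ => 1 - y) ⁻¹' (Set.Icc 0 1) = Set.Icc 0 1 := by
    ext y; simp only [Set.mem_preimage, Set.mem_Icc]; constructor <;> rintro ⟨a, b⟩ <;> constructor <;> linarith
  rw [e] at this
  exact this

theorem lint_refl (f : ℝ → ENNReal) (hf : Measurable f) :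
    ∫⁻ y, f (1 - y) ∂lam = ∫⁻ y, f y ∂lam := by
  conv_rhs => rw [← lam_refl]
  rw [lintegral_map hf (by fun_prop)]

def S (x : ℕ → ℝ) (i : ℕ) : Prop := x (i+1) < x i ∧ x i < x (i+2) ∧ x (i+2) < x (i+3)
def T (x : ℕ → ℝ) (i : ℕ) : Prop := x (i+3) < x (i+1) ∧ x (i+1) < x i ∧ x i < x (i+2)

theorem occ_S (σ : Equiv.Perm (Fin 4)) (hσ : σ 0 = 1 ∧ σ 1 = 0 ∧ σ 2 = 2 ∧ σ 3 = 3) (x i) :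
    OccursAt σ x i ↔ S x i := by
  obtain ⟨h0, h1, h2, h3⟩ := hσ
  constructor
  · intro h
    have a := h 1 0
    have b := h 0 2
    have c := h 2 3
    simp [h0, h1, h2, h3] at a b c
    exact ⟨a, b, c⟩
  · rintro ⟨a, b, c⟩ p q
    fin_cases p <;> fin_cases q <;> simp [h0, h1, h2, h3] <;> linarith

theorem occ_T (σ : Equiv.Perm (Fin 4)) (hσ : σ 0 = 2 ∧ σ 1 = 1 ∧ σ 2 = 3 ∧ σ 3 = 0) (x i) :
    OccursAt σ x i ↔ T x i := by
  obtain ⟨h0, h1, h2, h3⟩ := hσ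
  constructor
  · intro h
    have a := h 3 1
    have b := h 1 0
    have c := h 0 2
    simp [h0, h1, h2, h3] at a b c
    exact ⟨a, b, c⟩
  · rintro ⟨a, b, c⟩ p q
    fin_cases p <;> fin_cases q <;> simp [h0, h1, h2, h3] <;> linarith

/-- the four boxes -/
def box (b : ℕ → ℕ) (i : ℕ) : Set ℝ := Set.Ioo ((b (i % 4) : ℝ) / 4) (((b (i % 4) : ℝ) + 1) / 4)

theorem lam_box (b : ℕ → ℕ) (hb : ∀ i, b i < 4) (i : ℕ) : lam (box b i) = ENNReal.ofReal (1/4) := by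
  have h : (b (i % 4) : ℝ) + 1 ≤ 4 := by exact_mod_cast hb (i % 4)
  have h0 : (0:ℝ) ≤ (b (i % 4) : ℝ) := by positivity
  have mb : MeasurableSet (box b i) := measurableSet_Ioo
  rw [lam, Measure.restrict_apply mb, Set.inter_eq_left.2, box, Real.volume_Ioo]
  · congr 1; ring
  · intro y hy
    simp only [box, Set.mem_Ioo] at hy
    constructor <;> linarith [hy.1, hy.2]

theorem often (b : ℕ → ℕ) (hb : ∀ i, b i < 4) :
    ∀ᵐ x ∂mm, ∃ k : ℕ, ∀ j < 4, x (4 * k + j) ∈ box b j := by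
  classical
  set E : ℕ → Set (ℕ → ℝ) := fun k => Set.pi ((Finset.Ico (4*k) (4*k+4) : Finset ℕ) : Set ℕ) (box b)
    with hE
  have mb : ∀ i, MeasurableSet (box b i) := fun i => measurableSet_Ioo
  have hEm : ∀ k, MeasurableSet (E k) := fun k =>
    .pi (Finset.countable_toSet _) fun i _ => mb i
  have hEv : ∀ k, mm (E k) = ENNReal.ofReal (1/4) ^ 4 := by
    intro k
    rw [hE, Measure.infinitePi_pi _ (fun i _ => mb i)]
    simp [lam_box b hb]
  have hind : iIndepSet E mm := by
    rw [iIndepSet_iff_meas_biInter hEm]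
    intro s
    have e : (⋂ i ∈ s, E i) =
        Set.pi ((s.biUnion (fun k => Finset.Ico (4*k) (4*k+4)) : Finset ℕ) : Set ℕ) (box b) := by
      ext x
      simp only [hE, Set.mem_iInter, Set.mem_pi, Finset.mem_coe, Finset.mem_biUnion]
      constructor
      · rintro h i ⟨k, hk, hi⟩; exact h k hk i hi
      · intro h k hk i hi; exact h i ⟨k, hk, hi⟩
    rw [e, Measure.infinitePi_pi _ (fun i _ => mb i), Finset.prod_biUnion]
    · apply Finset.prod_congr rfl
      intro k _
      rw [hE, Measure.infinitePi_pi _ (fun i _ => mb i)]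
    · intro i _ j _ hij
      rw [Function.onFun, Finset.disjoint_left]
      intro a ha hb
      simp only [Finset.mem_Ico] at ha hb
      omega
  have h1 := measure_limsup_eq_one hEm hind (by
    simp_rw [hEv]
    exact ENNReal.tsum_const_eq_top_of_ne_zero (by simp))
  have h2 : ∀ᵐ x ∂mm, x ∈ Filter.limsup E Filter.atTop := by
    exact (mem_ae_iff_prob_eq_one (MeasurableSet.measurableSet_limsup hEm)).2 h1
  filter_upwards [h2] with x hx
  rw [Filter.mem_limsup_iff_frequently_mem] at hx
  obtain ⟨k, hk⟩ := hx.exists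
  refine ⟨k, fun j hj => ?_⟩
  have := hk (4*k+j) (by simp; omega)
  simpa [box, Nat.add_mod] using this

theorem ae_S : ∀ᵐ x ∂mm, ∃ k, S x k := by
  filter_upwards [often (fun i => if i = 0 then 1 else if i = 1 then 0 else if i = 2 then 2 else 3)
    (by intro i; split_ifs <;> omega)] with x ⟨k, hk⟩
  refine ⟨4*k, ?_⟩
  have a := hk 0 (by omega)
  have b := hk 1 (by omega)
  have c := hk 2 (by omega)
  have d := hk 3 (by omega)
  norm_num [box] at a b c d
  refine ⟨?_, ?_, ?_⟩ <;> linarith [a.1, a.2, b.1, b.2, c.1, c.2, d.1, d.2]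

theorem ae_T : ∀ᵐ x ∂mm, ∃ k, T x k := by
  filter_upwards [often (fun i => if i = 0 then 2 else if i = 1 then 1 else if i = 2 then 3 else 0)
    (by intro i; split_ifs <;> omega)] with x ⟨k, hk⟩
  refine ⟨4*k, ?_⟩
  have a := hk 0 (by omega)
  have b := hk 1 (by omega)
  have c := hk 2 (by omega)
  have d := hk 3 (by omega)
  norm_num [box] at a b c d
  refine ⟨?_, ?_, ?_⟩ <;> linarith [a.1, a.2, b.1, b.2, c.1, c.2, d.1, d.2]

theorem mand {α : Type*} [MeasurableSpace α] {p q : α → Prop} (hp : MeasurableSet {a | p a})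
    (hq : MeasurableSet {a | q a}) : MeasurableSet {a | p a ∧ q a} := hp.inter hq

theorem mor {α : Type*} [MeasurableSpace α] {p q : α → Prop} (hp : MeasurableSet {a | p a})
    (hq : MeasurableSet {a | q a}) : MeasurableSet {a | p a ∨ q a} := hp.union hq

/-- Sequences with no occurrence of either pattern among the coordinates `0..n`. -/
def A (n : ℕ) : Set (ℕ → ℝ) := {x | ∀ i, i + 3 ≤ n → ¬ S x i ∧ ¬ T x i}

theorem mS (i : ℕ) : MeasurableSet {x : ℕ → ℝ | S x i} := by
  unfold S
  exact mand (measurableSet_lt (by fun_prop) (by fun_prop)) (mand (measurableSet_lt (by fun_prop) (by fun_prop)) (measurableSet_lt (by fun_prop) (by fun_prop)))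

theorem mT (i : ℕ) : MeasurableSet {x : ℕ → ℝ | T x i} := by
  unfold T
  exact mand (measurableSet_lt (by fun_prop) (by fun_prop)) (mand (measurableSet_lt (by fun_prop) (by fun_prop)) (measurableSet_lt (by fun_prop) (by fun_prop)))

theorem mA (n : ℕ) : MeasurableSet (A n) := by
  have : A n = ⋂ i, ⋂ (_ : i + 3 ≤ n), ({x | S x i}ᶜ ∩ {x | T x i}ᶜ) := by
    ext x; simp [A]
  rw [this]
  exact .iInter fun i => .iInter fun _ => (mS i).compl.inter (mT i).compl

theorem A_update (n m : ℕ) (h : n < m) (x : ℕ → ℝ) (y : ℝ) :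
    Function.update x m y ∈ A n ↔ x ∈ A n := by
  simp only [A, Set.mem_ofPred_eq]
  refine forall_congr' fun i => imp_congr_right fun hi => ?_
  simp only [S, T, Function.update_of_ne (show i ≠ m by omega),
    Function.update_of_ne (show i + 1 ≠ m by omega),
    Function.update_of_ne (show i + 2 ≠ m by omega),
    Function.update_of_ne (show i + 3 ≠ m by omega)]

theorem A_succ (m : ℕ) (x : ℕ → ℝ) : x ∈ A (m + 3) ↔ x ∈ A (m + 2) ∧ ¬ S x m ∧ ¬ T x m := by
  simp only [A, Set.mem_ofPred_eq]
  constructor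
  · intro h
    exact ⟨fun i hi => h i (by omega), h m le_rfl⟩
  · rintro ⟨h1, h2⟩ i hi
    by_cases e : i = m
    · subst e; exact h2
    · exact h1 i (by omega)

theorem A_small (n : ℕ) (hn : n < 3) (x : ℕ → ℝ) : x ∈ A n := by
  intro i hi; omega

open Classical in
def U (n : ℕ) (φ : ℝ → ENNReal) : ENNReal := ∫⁻ x, (if x ∈ A n then φ (x n) else 0) ∂mm

open Classical in
def G (n : ℕ) (ψ : ℝ → ℝ → ENNReal) : ENNReal :=
  ∫⁻ x, (if x ∈ A (n + 2) ∧ x (n + 1) < x n ∧ x n < x (n + 2)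
    then ψ (x (n + 1)) (x (n + 2)) else 0) ∂mm

theorem G_le (n : ℕ) (ψ : ℝ → ℝ → ENNReal) (h : ∀ b c, ψ b c ≤ 1) : G n ψ ≠ ⊤ := by
  have : G n ψ ≤ ∫⁻ _, 1 ∂mm := by
    refine lintegral_mono fun x => ?_
    split_ifs
    · exact h _ _
    · exact zero_le
  rw [lintegral_one, measure_univ] at this
  exact ne_top_of_le_ne_top ENNReal.one_ne_top this

theorem resample2 (n : ℕ) (f : (ℕ → ℝ) → ℝ → ℝ → ENNReal)
    (hf : Measurable (fun p : ((ℕ → ℝ) × ℝ) × ℝ => f p.1.1 p.1.2 p.2))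
    (h0 : ∀ x y b c, f (Function.update x n y) b c = f x b c)
    (h1 : ∀ x y b c, f (Function.update x (n + 1) y) b c = f x b c) :
    ∫⁻ x, f x (x n) (x (n + 1)) ∂mm = ∫⁻ x, ∫⁻ b, ∫⁻ c, f x b c ∂lam ∂lam ∂mm := by
  rw [resample (n + 1) (fun x c => f x (x n) c)]
  · rw [resample n (fun x b => ∫⁻ c, f x b c ∂lam)]
    · exact hf.lintegral_prod_right'
    · intro x y z; simp only [h0]
  · exact hf.comp (((measurable_fst).prodMk
      ((measurable_pi_apply n).comp measurable_fst)).prodMk measurable_snd)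
  · intro x y z
    simp [h1]

/-- Two-fold integral over the square. -/
theorem dbl_refl (h : ℝ → ℝ → ENNReal) (hh : Measurable (Function.uncurry h)) :
    ∫⁻ b, ∫⁻ c, h (1 - c) (1 - b) ∂lam ∂lam = ∫⁻ b, ∫⁻ c, h b c ∂lam ∂lam := by
  have e1 : ∀ b, ∫⁻ c, h (1 - c) (1 - b) ∂lam = ∫⁻ c, h c (1 - b) ∂lam := fun b =>
    lint_refl (fun c => h c (1 - b)) (hh.comp (measurable_id.prodMk measurable_const))
  simp_rw [e1]
  have hs : Measurable (Function.uncurry fun b c => h c b) := hh.comp measurable_swap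
  rw [lint_refl (fun b => ∫⁻ c, h c b ∂lam) hs.lintegral_prod_right',
    lintegral_lintegral_swap hs.aemeasurable]

open Classical in
def Phi (φ : ℝ → ENNReal) (b c : ℝ) : ENNReal := ∫⁻ y, (if c < y ∨ y < b then φ y else 0) ∂lam

open Classical in
def Psi (ψ : ℝ → ℝ → ENNReal) (b' c' : ℝ) : ENNReal :=
  ∫⁻ b, ∫⁻ c, (if b < b' ∧ c' < c then ψ b c else 0) ∂lam ∂lam

open Classical in
def theta (ψ : ℝ → ℝ → ENNReal) (a : ℝ) : ENNReal :=
  ∫⁻ b, ∫⁻ c, (if b < a ∧ a < c then ψ b c else 0) ∂lam ∂lam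

theorem lint_le (f : ℝ → ENNReal) (h : ∀ y, f y ≤ 1) : ∫⁻ y, f y ∂lam ≤ 1 := by
  calc _ ≤ ∫⁻ _, 1 ∂lam := lintegral_mono h
    _ = 1 := by simp

theorem Phi_le (φ : ℝ → ENNReal) (h : ∀ y, φ y ≤ 1) (b c) : Phi φ b c ≤ 1 :=
  lint_le _ fun y => by split_ifs <;> simp [h]
theorem Psi_le (ψ : ℝ → ℝ → ENNReal) (h : ∀ b c, ψ b c ≤ 1) (b c) : Psi ψ b c ≤ 1 :=
  lint_le _ fun y => lint_le _ fun z => by split_ifs <;> simp [h]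
theorem theta_le (ψ : ℝ → ℝ → ENNReal) (h : ∀ b c, ψ b c ≤ 1) (a) : theta ψ a ≤ 1 :=
  lint_le _ fun y => lint_le _ fun z => by split_ifs <;> simp [h]

theorem Phi_meas (φ : ℝ → ENNReal) (h : Measurable φ) : Measurable (Function.uncurry (Phi φ)) := by
  have : Measurable (fun p : (ℝ × ℝ) × ℝ => if p.1.2 < p.2 ∨ p.2 < p.1.1 then φ p.2 else 0) :=
    Measurable.ite (mor (measurableSet_lt (by fun_prop) (by fun_prop)) (measurableSet_lt (by fun_prop) (by fun_prop))) (by fun_prop) measurable_const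
  convert this.lintegral_prod_right' (ν := lam) using 1
  ext p
  simp only [Function.uncurry, Phi]

theorem Psi_meas (ψ : ℝ → ℝ → ENNReal) (h : Measurable (Function.uncurry ψ)) :
    Measurable (Function.uncurry (Psi ψ)) := by
  have : Measurable (fun p : ((ℝ × ℝ) × ℝ) × ℝ =>
      if p.1.2 < p.1.1.1 ∧ p.1.1.2 < p.2 then ψ p.1.2 p.2 else 0) :=
    Measurable.ite (mand (measurableSet_lt (by fun_prop) (by fun_prop)) (measurableSet_lt (by fun_prop) (by fun_prop)))
      (h.comp ((measurable_snd.comp measurable_fst).prodMk measurable_snd)) measurable_const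
  convert (this.lintegral_prod_right' (ν := lam)).lintegral_prod_right' (ν := lam) using 1
  ext p
  simp only [Function.uncurry, Psi]

theorem theta_meas (ψ : ℝ → ℝ → ENNReal) (h : Measurable (Function.uncurry ψ)) :
    Measurable (theta ψ) := by
  have : Measurable (fun p : (ℝ × ℝ) × ℝ =>
      if p.1.2 < p.1.1 ∧ p.1.1 < p.2 then ψ p.1.2 p.2 else 0) :=
    Measurable.ite (mand (measurableSet_lt (by fun_prop) (by fun_prop)) (measurableSet_lt (by fun_prop) (by fun_prop)))
      (h.comp ((measurable_snd.comp measurable_fst).prodMk measurable_snd)) measurable_const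
  convert (this.lintegral_prod_right' (ν := lam)).lintegral_prod_right' (ν := lam) using 1
  ext p
  simp only [theta]

/-- reflected test function -/
def star2 (ψ : ℝ → ℝ → ENNReal) (b c : ℝ) : ENNReal := ψ (1 - c) (1 - b)

theorem star2_meas (ψ : ℝ → ℝ → ENNReal) (h : Measurable (Function.uncurry ψ)) :
    Measurable (Function.uncurry (star2 ψ)) :=
  h.comp (show Measurable (fun p : ℝ × ℝ => (1 - p.2, 1 - p.1)) by fun_prop)

theorem Phi_star (φ : ℝ → ENNReal) (h : Measurable φ) :
    Phi (fun y => φ (1 - y)) = star2 (Phi φ) := by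
  ext b c
  simp only [Phi, star2]
  rw [← lint_refl (fun y => if 1 - b < y ∨ y < 1 - c then φ y else 0)]
  · congr! 3 with y
    · constructor <;> (rintro (h | h)) <;> [right; left; right; left] <;> linarith
  · exact Measurable.ite (mor (measurableSet_lt (by fun_prop) (by fun_prop)) (measurableSet_lt (by fun_prop) (by fun_prop))) h measurable_const

theorem Psi_star (ψ : ℝ → ℝ → ENNReal) (h : Measurable (Function.uncurry ψ)) :
    Psi (star2 ψ) = star2 (Psi ψ) := by
  ext b' c'
  simp only [Psi]
  show _ = Psi ψ (1 - c') (1 - b')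
  simp only [Psi]
  rw [← dbl_refl (fun b c => if b < 1 - c' ∧ 1 - b' < c then ψ b c else 0)]
  · congr! 5 with b c
    · constructor <;> (rintro ⟨h, h'⟩) <;> constructor <;> linarith
  · exact Measurable.ite (mand (measurableSet_lt (by fun_prop) (by fun_prop)) (measurableSet_lt (by fun_prop) (by fun_prop))) h measurable_const

theorem theta_star (ψ : ℝ → ℝ → ENNReal) (h : Measurable (Function.uncurry ψ)) :
    theta (star2 ψ) = fun a => theta ψ (1 - a) := by
  ext a
  simp only [theta]
  rw [← dbl_refl (fun b c => if b < 1 - a ∧ 1 - a < c then ψ b c else 0)]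
  · congr! 5 with b c
    · constructor <;> (rintro ⟨h, h'⟩) <;> constructor <;> linarith
  · exact Measurable.ite (mand (measurableSet_lt (by fun_prop) (by fun_prop)) (measurableSet_lt (by fun_prop) (by fun_prop))) h measurable_const

/-- measurability of the 213 event -/
theorem m213 (n : ℕ) : MeasurableSet
    {x : ℕ → ℝ | x ∈ A (n + 2) ∧ x (n + 1) < x n ∧ x n < x (n + 2)} :=
  mand (mA _) (mand (measurableSet_lt (by fun_prop) (by fun_prop)) (measurableSet_lt (by fun_prop) (by fun_prop)))

open Classical in
/-- One-step expansion of `G`. -/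
theorem G_step (m : ℕ) (R : ℝ → ℝ → ℝ → Prop) (φ : ℝ → ENNReal) (hφ : Measurable φ)
    (hR : MeasurableSet {p : (ℝ × ℝ) × ℝ | R p.1.1 p.1.2 p.2}) :
    G m (fun b c => ∫⁻ y, (if R b c y then φ y else 0) ∂lam) =
    ∫⁻ x, (if (x ∈ A (m + 2) ∧ x (m + 1) < x m ∧ x m < x (m + 2)) ∧
      R (x (m + 1)) (x (m + 2)) (x (m + 3)) then φ (x (m + 3)) else 0) ∂mm := by
  rw [resample (m + 3) (fun x y => if (x ∈ A (m + 2) ∧ x (m + 1) < x m ∧ x m < x (m + 2)) ∧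
      R (x (m + 1)) (x (m + 2)) y then φ y else 0)]
  · refine lintegral_congr fun x => ?_
    by_cases h : x ∈ A (m + 2) ∧ x (m + 1) < x m ∧ x m < x (m + 2) <;> simp [h]
  · refine Measurable.ite (mand ((m213 m).preimage measurable_fst) ?_) (by fun_prop)
      measurable_const
    exact hR.preimage (show Measurable (fun p : (ℕ → ℝ) × ℝ =>
      ((p.1 (m + 1), p.1 (m + 2)), p.2)) by fun_prop)
  · intro x y z
    simp [A_update]

theorem rec_U (m : ℕ) (φ : ℝ → ENNReal) (hφ : Measurable φ) :
    U (m + 3) φ + G m (Phi φ) = mm (A (m + 2)) * ∫⁻ y, φ y ∂lam := by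
  classical
  have hr := resample (m + 3) (fun x y => if x ∈ A (m + 2) then φ y else 0)
    (Measurable.ite ((mA _).preimage measurable_fst) (by fun_prop) measurable_const)
    (by intro x y z; simp [A_update])
  have hc : ∫⁻ x, ∫⁻ y, (if x ∈ A (m + 2) then φ y else 0) ∂lam ∂mm =
      mm (A (m + 2)) * ∫⁻ y, φ y ∂lam := by
    have : ∀ x, ∫⁻ y, (if x ∈ A (m + 2) then φ y else 0) ∂lam =
        (A (m + 2)).indicator (fun _ => ∫⁻ y, φ y ∂lam) x := by
      intro x
      by_cases h : x ∈ A (m + 2) <;> simp [h]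
    simp_rw [this]
    rw [lintegral_indicator_const (mA _), mul_comm]
  rw [← hc, ← hr]
  have hG : G m (Phi φ) = _ := Eq.trans (by congr 1; ext b c; simp only [Phi]; congr!)
    (G_step m (fun b c y => c < y ∨ y < b) φ hφ
    (mor (measurableSet_lt (by fun_prop) (by fun_prop))
      (measurableSet_lt (by fun_prop) (by fun_prop))))
  rw [hG, U, ← lintegral_add_left]
  · refine lintegral_congr fun x => ?_
    rw [A_succ]
    by_cases hA : x ∈ A (m + 2)
    · by_cases h : S x m ∨ T x m
      · have h1 : ¬ (x ∈ A (m + 2) ∧ ¬ S x m ∧ ¬ T x m) := by tauto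
        have h2 : (x ∈ A (m + 2) ∧ x (m + 1) < x m ∧ x m < x (m + 2)) ∧
          (x (m + 2) < x (m + 3) ∨ x (m + 3) < x (m + 1)) := by
          unfold S T at h; tauto
        rw [if_neg h1, if_pos h2, if_pos hA, zero_add]
      · have h1 : (x ∈ A (m + 2) ∧ ¬ S x m ∧ ¬ T x m) := by tauto
        have h2 : ¬ ((x ∈ A (m + 2) ∧ x (m + 1) < x m ∧ x m < x (m + 2)) ∧
          (x (m + 2) < x (m + 3) ∨ x (m + 3) < x (m + 1))) := by
          unfold S T at h; tauto
        rw [if_pos h1, if_neg h2, if_pos hA, add_zero]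
    · simp [hA]
  · exact Measurable.ite (mA _) (by fun_prop) measurable_const

open Classical in
theorem U_theta (n : ℕ) (ψ : ℝ → ℝ → ENNReal) (h : Measurable (Function.uncurry ψ)) :
    U n (theta ψ) = ∫⁻ x, (if x ∈ A n ∧ x (n + 1) < x n ∧ x n < x (n + 2)
      then ψ (x (n + 1)) (x (n + 2)) else 0) ∂mm := by
  rw [resample2 (n + 1) (fun x b c => if x ∈ A n ∧ b < x n ∧ x n < c then ψ b c else 0)]
  · refine lintegral_congr fun x => ?_
    by_cases h : x ∈ A n <;> simp [h, theta]
  · refine Measurable.ite (mand ((mA n).preimage (by fun_prop))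
      (mand (measurableSet_lt (by fun_prop) (by fun_prop)) (measurableSet_lt (by fun_prop) (by fun_prop)))) ?_ measurable_const
    exact h.comp (show Measurable (fun p : ((ℕ → ℝ) × ℝ) × ℝ => (p.1.2, p.2)) by fun_prop)
  · intro x y b c
    simp [A_update]
  · intro x y b c
    simp [A_update n (n + 1 + 1) (by omega), Function.update_of_ne (show n ≠ n + 1 + 1 by omega)]

open Classical in
theorem G_Psi (k : ℕ) (ψ : ℝ → ℝ → ENNReal) (h : Measurable (Function.uncurry ψ)) :
    G k (Psi ψ) = ∫⁻ x, (if (x ∈ A (k + 2) ∧ x (k + 1) < x k ∧ x k < x (k + 2)) ∧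
      x (k + 3) < x (k + 1) ∧ x (k + 2) < x (k + 4)
      then ψ (x (k + 3)) (x (k + 4)) else 0) ∂mm := by
  rw [resample2 (k + 3) (fun x b c => if (x ∈ A (k + 2) ∧ x (k + 1) < x k ∧ x k < x (k + 2)) ∧
      b < x (k + 1) ∧ x (k + 2) < c then ψ b c else 0)]
  · refine lintegral_congr fun x => ?_
    by_cases h : x ∈ A (k + 2) ∧ x (k + 1) < x k ∧ x k < x (k + 2) <;> simp [h, Psi]
  · refine Measurable.ite (mand ((m213 k).preimage (by fun_prop))
      (mand (measurableSet_lt (by fun_prop) (by fun_prop)) (measurableSet_lt (by fun_prop) (by fun_prop)))) ?_ measurable_const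
    exact h.comp (show Measurable (fun p : ((ℕ → ℝ) × ℝ) × ℝ => (p.1.2, p.2)) by fun_prop)
  · intro x y b c
    simp [A_update]
  · intro x y b c
    simp [A_update (k + 2) (k + 3 + 1) (by omega), Function.update_of_ne (show k ≠ k + 3 + 1 by omega)]

theorem A_213 (n : ℕ) (x : ℕ → ℝ) (h1 : x (n + 1) < x n) (h2 : x n < x (n + 2)) :
    x ∈ A (n + 2) ↔ x ∈ A (n + 1) := by
  rcases n with _ | n
  · simp [A_small]
  · rw [show n + 1 + 2 = n + 3 by omega, A_succ, show n + 1 + 1 = n + 2 by omega]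
    refine ⟨fun h => h.1, fun h => ⟨h, ?_, ?_⟩⟩
    · rintro ⟨a, b, c⟩
      exact absurd h1 (by rw [show n + 1 + 1 = n + 2 by omega]; linarith)
    · rintro ⟨a, b, c⟩
      rw [show n + 1 + 2 = n + 3 by omega] at h2
      linarith

theorem rec_G (k : ℕ) (ψ : ℝ → ℝ → ENNReal) (h : Measurable (Function.uncurry ψ)) :
    G (k + 2) ψ + G k (Psi ψ) = U (k + 2) (theta ψ) := by
  classical
  rw [U_theta _ _ h, G_Psi _ _ h, G, ← lintegral_add_left]
  · refine lintegral_congr fun x => ?_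
    show (if x ∈ A (k + 2 + 2) ∧ x (k + 3) < x (k + 2) ∧ x (k + 2) < x (k + 4)
       then ψ (x (k + 3)) (x (k + 4)) else 0) + _ =
       if x ∈ A (k + 2) ∧ x (k + 3) < x (k + 2) ∧ x (k + 2) < x (k + 4)
       then ψ (x (k + 3)) (x (k + 4)) else 0
    by_cases hd : x (k + 3) < x (k + 2) ∧ x (k + 2) < x (k + 4)
    · rw [A_213 (k + 2) x hd.1 hd.2]
      show (if x ∈ A (k + 3) ∧ _ then _ else _) + _ = _
      rw [A_succ]
      have hS : ¬ S x k := by rintro ⟨a, b, c⟩; linarith [hd.1]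
      by_cases hA : x ∈ A (k + 2)
      · by_cases hT : T x k
        · have h2 : (x ∈ A (k + 2) ∧ x (k + 1) < x k ∧ x k < x (k + 2)) ∧
              x (k + 3) < x (k + 1) ∧ x (k + 2) < x (k + 4) := ⟨⟨hA, hT.2⟩, hT.1, hd.2⟩
          simp [hA, hT, hd, h2]
        · have h2 : ¬ ((x ∈ A (k + 2) ∧ x (k + 1) < x k ∧ x k < x (k + 2)) ∧
              x (k + 3) < x (k + 1) ∧ x (k + 2) < x (k + 4)) :=
            fun h => hT ⟨h.2.1, h.1.2⟩
          rw [if_neg h2]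
          simp [hA, hT, hS, hd]
      · simp [hA]
    · rw [if_neg (fun h => hd h.2), if_neg (c := x ∈ A (k + 2) ∧ x (k + 3) < x (k + 2) ∧ x (k + 2) < x (k + 4)) (fun h => hd h.2), if_neg, add_zero]
      rintro ⟨⟨a, b, c⟩, d, e⟩
      exact hd ⟨by linarith, e⟩
  · exact Measurable.ite (m213 _) (h.comp (show Measurable (fun x : ℕ → ℝ =>
      (x (k + 2 + 1), x (k + 2 + 2))) by fun_prop)) measurable_const

theorem G_small (n : ℕ) (hn : n < 2) (ψ : ℝ → ℝ → ENNReal) (h : Measurable (Function.uncurry ψ)) :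
    G n ψ = U n (theta ψ) := by
  classical
  rw [U_theta _ _ h, G]
  refine lintegral_congr fun x => ?_
  by_cases hd : x (n + 1) < x n ∧ x n < x (n + 2)
  · rw [A_213 n x hd.1 hd.2]
    simp [A_small n (by omega), A_small (n + 1) (by omega)]
  · simp [hd]

theorem U_small (n : ℕ) (hn : n < 3) (φ : ℝ → ENNReal) (h : Measurable φ) :
    U n φ = ∫⁻ y, φ y ∂lam := by
  simp only [U, A_small n hn, if_true]
  rw [resample n (fun _ y => φ y) (h.comp measurable_snd) (fun _ _ _ => rfl)]
  simp

theorem symm (n : ℕ) :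
    (∀ φ : ℝ → ENNReal, Measurable φ → (∀ y, φ y ≤ 1) → U n (fun y => φ (1 - y)) = U n φ) ∧
    (∀ ψ : ℝ → ℝ → ENNReal, Measurable (Function.uncurry ψ) → (∀ b c, ψ b c ≤ 1) →
      G n (star2 ψ) = G n ψ) := by
  induction n using Nat.strong_induction_on with
  | _ n ih =>
  have hU : ∀ φ : ℝ → ENNReal, Measurable φ → (∀ y, φ y ≤ 1) →
      U n (fun y => φ (1 - y)) = U n φ := by
    intro φ hφ h1
    have hφ' : Measurable (fun y => φ (1 - y)) := by fun_prop
    by_cases hn : n < 3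
    · rw [U_small n hn _ hφ, U_small n hn _ hφ', lint_refl φ hφ]
    · obtain ⟨m, rfl⟩ : ∃ m, n = m + 3 := ⟨n - 3, by omega⟩
      have e1 := rec_U m φ hφ
      have e2 := rec_U m _ hφ'
      rw [lint_refl φ hφ, ← e1, Phi_star φ hφ,
        (ih m (by omega)).2 _ (Phi_meas φ hφ) (Phi_le φ h1)] at e2
      exact (ENNReal.add_left_inj (G_le m _ (Phi_le φ h1))).1 e2
  refine ⟨hU, ?_⟩
  intro ψ hψ h1
  have hψ' := star2_meas ψ hψ
  have hth : U n (theta (star2 ψ)) = U n (theta ψ) := by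
    rw [theta_star ψ hψ, hU _ (theta_meas ψ hψ) (theta_le ψ h1)]
  by_cases hn : n < 2
  · rw [G_small n hn _ hψ, G_small n hn _ hψ', hth]
  · obtain ⟨k, rfl⟩ : ∃ k, n = k + 2 := ⟨n - 2, by omega⟩
    have e1 := rec_G k ψ hψ
    have e2 := rec_G k _ hψ'
    rw [hth, ← e1, Psi_star ψ hψ,
      (ih k (by omega)).2 _ (Psi_meas ψ hψ) (Psi_le ψ h1)] at e2
    exact (ENNReal.add_left_inj (G_le k _ (Psi_le ψ h1))).1 e2

theorem eq_step (m : ℕ) : mm (A (m + 2) ∩ {x | S x m}) = mm (A (m + 2) ∩ {x | T x m}) := by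
  classical
  have e1 := G_step m (fun _ c y => c < y) (fun _ => 1) measurable_const
    (measurableSet_lt (by fun_prop) (by fun_prop))
  have e2 := G_step m (fun b _ y => y < b) (fun _ => 1) measurable_const
    (measurableSet_lt (by fun_prop) (by fun_prop))
  have c1 : mm (A (m + 2) ∩ {x | S x m}) = G m (fun _ c => ∫⁻ y, (if c < y then 1 else 0) ∂lam) := by
    rw [e1, ← lintegral_indicator_one ((mA _).inter (mS m))]
    refine lintegral_congr fun x => ?_
    simp [Set.indicator_apply, S, and_assoc]
  have c2 : mm (A (m + 2) ∩ {x | T x m}) = G m (fun b _ => ∫⁻ y, (if y < b then 1 else 0) ∂lam) := by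
    rw [e2, ← lintegral_indicator_one ((mA _).inter (mT m))]
    refine lintegral_congr fun x => ?_
    simp only [Set.indicator_apply, T, Set.mem_inter_iff, Set.mem_ofPred_eq, Pi.one_apply]
    congr 1
    apply propext; tauto
  rw [c1, c2, ← (symm m).2 (fun b _ => ∫⁻ y, (if y < b then 1 else 0) ∂lam)]
  · congr 1
    ext b c
    simp only [star2]
    rw [← lint_refl (fun y => if c < y then 1 else 0)]
    · congr! 3 with y
      constructor <;> intro h <;> linarith
    · exact Measurable.ite (measurableSet_lt (by fun_prop) (by fun_prop)) measurable_const
        measurable_const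
  · have : Measurable (fun p : (ℝ × ℝ) × ℝ => if p.2 < p.1.1 then (1 : ENNReal) else 0) :=
      Measurable.ite (measurableSet_lt (by fun_prop) (by fun_prop)) measurable_const
        measurable_const
    exact this.lintegral_prod_right' (ν := lam)
  · intro b c
    exact lint_le _ fun y => by split_ifs <;> simp

theorem not_both (x : ℕ → ℝ) (m : ℕ) (hS : S x m) (hT : T x m) : False := by
  obtain ⟨a, b, c⟩ := hS
  obtain ⟨d, e, f⟩ := hT
  linarith

/-- comparison of first hitting times -/
theorem hit_lt (P Q : ℕ → Prop) (hP : ∃ k, P k) (hQ : ∃ k, Q k) (hPQ : ∀ k, P k → Q k → False) :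
    sInf {j | 4 ≤ j ∧ P (j - 4)} < sInf {j | 4 ≤ j ∧ Q (j - 4)} ↔
      ∃ m, (∀ i, i + 3 ≤ m + 2 → ¬ P i ∧ ¬ Q i) ∧ P m := by
  obtain ⟨p, hp⟩ := hP
  obtain ⟨q, hq⟩ := hQ
  have h1 : sInf {j | 4 ≤ j ∧ P (j - 4)} ∈ {j | 4 ≤ j ∧ P (j - 4)} :=
    Nat.sInf_mem ⟨p + 4, by simpa using hp⟩
  have h2 : sInf {j | 4 ≤ j ∧ Q (j - 4)} ∈ {j | 4 ≤ j ∧ Q (j - 4)} :=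
    Nat.sInf_mem ⟨q + 4, by simpa using hq⟩
  have l1 : ∀ i, P i → sInf {j | 4 ≤ j ∧ P (j - 4)} ≤ i + 4 := fun i hi =>
    Nat.sInf_le (by simpa using hi)
  have l2 : ∀ i, Q i → sInf {j | 4 ≤ j ∧ Q (j - 4)} ≤ i + 4 := fun i hi =>
    Nat.sInf_le (by simpa using hi)
  generalize sInf {j | 4 ≤ j ∧ P (j - 4)} = s at *
  generalize sInf {j | 4 ≤ j ∧ Q (j - 4)} = t at *
  simp only [Set.mem_ofPred_eq] at h1 h2
  constructor
  · intro h
    refine ⟨s - 4, fun i hi => ⟨fun hPi => ?_, fun hQi => ?_⟩, h1.2⟩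
    · have := l1 i hPi; omega
    · have := l2 i hQi; omega
  · rintro ⟨m, hm, hPm⟩
    have hs := l1 m hPm
    by_contra hlt
    by_cases e : t - 4 = m
    · exact hPQ m hPm (e ▸ h2.2)
    · exact (hm (t - 4) (by omega)).2 h2.2

theorem final (σ τ : Equiv.Perm (Fin 4))
    (hσ : σ 0 = 1 ∧ σ 1 = 0 ∧ σ 2 = 2 ∧ σ 3 = 3)
    (hτ : τ 0 = 2 ∧ τ 1 = 1 ∧ τ 2 = 3 ∧ τ 3 = 0) :
    mm {x | hitTime σ x < hitTime τ x} = 1 / 2 := by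
  have eS : ∀ x, hitTime σ x = sInf {j | 4 ≤ j ∧ S x (j - 4)} := by
    intro x; simp only [hitTime, occ_S σ hσ]
  have eT : ∀ x, hitTime τ x = sInf {j | 4 ≤ j ∧ T x (j - 4)} := by
    intro x; simp only [hitTime, occ_T τ hτ]
  set B : Set (ℕ → ℝ) := ⋃ m, (A (m + 2) ∩ {x | S x m}) with hB
  set C : Set (ℕ → ℝ) := ⋃ m, (A (m + 2) ∩ {x | T x m}) with hC
  have mB : MeasurableSet B := .iUnion fun m => (mA _).inter (mS m)
  have mC : MeasurableSet C := .iUnion fun m => (mA _).inter (mT m)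
  have hBC : mm B = mm C := by
    rw [hB, hC, measure_iUnion, measure_iUnion]
    · simp_rw [eq_step]
    · intro i j hij
      rw [Function.onFun, Set.disjoint_left]
      rintro x ⟨h1, h2⟩ ⟨h3, h4⟩
      rcases Nat.lt_or_gt_of_ne hij with h | h
      · exact (h3 i (by omega)).2 h2
      · exact (h1 j (by omega)).2 h4
    · exact fun m => (mA _).inter (mT m)
    · intro i j hij
      rw [Function.onFun, Set.disjoint_left]
      rintro x ⟨h1, h2⟩ ⟨h3, h4⟩
      rcases Nat.lt_or_gt_of_ne hij with h | h
      · exact (h3 i (by omega)).1 h2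
      · exact (h1 j (by omega)).1 h4
    · exact fun m => (mA _).inter (mS m)
  have aeB : ∀ᵐ x ∂mm, (hitTime σ x < hitTime τ x ↔ x ∈ B) ∧
      (hitTime τ x < hitTime σ x ↔ x ∈ C) ∧ hitTime σ x ≠ hitTime τ x := by
    filter_upwards [ae_S, ae_T] with x hS hT
    rw [eS, eT]
    refine ⟨?_, ?_, ?_⟩
    · rw [hit_lt (S x) (T x) hS hT (not_both x)]
      simp [hB, A]
    · rw [hit_lt (T x) (S x) hT hS (fun k a b => not_both x k b a)]
      simp only [hC, A, Set.mem_iUnion, Set.mem_inter_iff, Set.mem_ofPred_eq]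
      refine exists_congr fun m => and_congr_left fun _ => forall_congr' fun i =>
        imp_congr_right fun _ => and_comm
    · intro h
      obtain ⟨p, hp⟩ := hS
      obtain ⟨q, hq⟩ := hT
      have h1 : sInf {j | 4 ≤ j ∧ S x (j - 4)} ∈ {j | 4 ≤ j ∧ S x (j - 4)} :=
        Nat.sInf_mem ⟨p + 4, by simpa using hp⟩
      have h2 : sInf {j | 4 ≤ j ∧ T x (j - 4)} ∈ {j | 4 ≤ j ∧ T x (j - 4)} :=
        Nat.sInf_mem ⟨q + 4, by simpa using hq⟩
      rw [← h] at h2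
      exact not_both x _ h1.2 h2.2
  have e : mm {x | hitTime σ x < hitTime τ x} = mm B :=
    measure_congr (Filter.eventuallyEq_set.2 (aeB.mono fun x hx => hx.1))
  have hcompl : mm C = mm Bᶜ := by
    refine measure_congr (Filter.eventuallyEq_set.2 (aeB.mono fun x hx => ?_))
    rw [Set.mem_compl_iff, ← hx.1, ← hx.2.1]
    have := hx.2.2
    omega
  have hsum : mm B + mm B = 1 := by
    have := measure_add_measure_compl (μ := mm) mB
    rw [← hcompl, ← hBC, measure_univ] at this
    exact this
  rw [e, ENNReal.eq_div_iff (by norm_num) (by norm_num), two_mul, hsum]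

end Tie

theorem tie_2134_3241 (μ : Measure (ℕ → ℝ)) (hμ : IsIIDUniform μ)
    (σ τ : Equiv.Perm (Fin 4))
    (hσ : σ 0 = 1 ∧ σ 1 = 0 ∧ σ 2 = 2 ∧ σ 3 = 3)
    (hτ : τ 0 = 2 ∧ τ 1 = 1 ∧ τ 2 = 3 ∧ τ 3 = 0) :
    μ {x | hitTime σ x < hitTime τ x} = 1 / 2 := by
  have h := Tie.eq_inf μ hμ
  rw [h]
  exact Tie.final σ τ hσ hτ

end
end
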